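/- Let d ≥ 1, p ∈ [1, ∞), β ∈ (2, ∞) and L > 0. Then for every sequence {b_n : n ∈ ℕ} with b_n ∈ (0,1), the Dirichlet kernel density estimators satisfy liminf_{n→∞} [ sup_{f ∈ Σ(d,β,L)} (E_f ‖f̂_{n,b_n} − f‖_p^p)^{1/p} ] / n^{−β/(d+2β)} = ∞; i.e., the estimator is never minimax over Σ(d,β,L) when β > 2. -/

import Mathlib

open MeasureTheory Filter Topology
open scoped ENNReal BigOperators

noncomputable section

/-- The d-dimensional simplex `S_d = {s ∈ [0,1]^d : s_1 + ⋯ + s_d ≤ 1}`. -/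
def Sd (d : ℕ) : Set (Fin d → ℝ) :=
  {s | (∀ i, 0 ≤ s i ∧ s i ≤ 1) ∧ ∑ i, s i ≤ 1}

/-- The Dirichlet density `K_{u,v}` on `S_d` (0 outside). -/
def dirK (d : ℕ) (u : Fin d → ℝ) (v : ℝ) : (Fin d → ℝ) → ℝ :=
  Set.indicator (Sd d)
    (fun s => Real.Gamma (v + ∑ i, u i) / (Real.Gamma v * ∏ i, Real.Gamma (u i)) *
      (1 - ∑ i, s i) ^ (v - 1) * ∏ i, (s i) ^ (u i - 1))

/-- The Dirichlet kernel `K_{s/b+1, (1-‖s‖₁)/b+1}` at location `s` with bandwidth `b`. -/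
def dirKb (d : ℕ) (b : ℝ) (s : Fin d → ℝ) : (Fin d → ℝ) → ℝ :=
  dirK d (fun i => s i / b + 1) ((1 - ∑ i, s i) / b + 1)

/-- The Dirichlet kernel density estimator based on the sample `X`. -/
def fhat (d n : ℕ) (b : ℝ) (X : Fin n → Fin d → ℝ) (s : Fin d → ℝ) : ℝ :=
  (n : ℝ)⁻¹ * ∑ i, dirKb d b s (X i)

/-- `m` = the largest integer strictly less than `β` (for `β > 0`). -/
def mOf (β : ℝ) : ℕ := ⌈β⌉₊ - 1

/-- Partial derivative of order `j` in the directions `v` (on the interior of the simplex). -/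
def Dpartial (d j : ℕ) (f : (Fin d → ℝ) → ℝ) (v : Fin j → Fin d) (s : Fin d → ℝ) : ℝ :=
  iteratedFDerivWithin ℝ j f (interior (Sd d)) s fun i => Pi.single (v i) 1

/-- The Hölder class `Σ(d, β, L)` of probability densities supported on `S_d`. -/
def holderClass (d : ℕ) (β L : ℝ) : Set ((Fin d → ℝ) → ℝ) :=
  {f | (∀ s, 0 ≤ f s) ∧ (∀ s, s ∉ Sd d → f s = 0) ∧ (∫ s in Sd d, f s) = 1 ∧
    ContDiffOn ℝ (mOf β) f (interior (Sd d)) ∧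
    ∀ v : Fin (mOf β) → Fin d, ∀ s ∈ interior (Sd d), ∀ t ∈ interior (Sd d),
      |Dpartial d (mOf β) f v s - Dpartial d (mOf β) f v t| ≤
        L * (∑ i, |s i - t i|) ^ (β - (mOf β : ℝ))}

/-- `E_f ‖f̂_{n,b} − f‖_p^p`: expectation, under i.i.d. sampling of `X_1, …, X_n` from the
density `f`, of the `p`-th power of the `L^p` distance between `f̂_{n,b}` and `f` on `S_d`. -/
def lpRiskPow (d n : ℕ) (b p : ℝ) (f : (Fin d → ℝ) → ℝ) : ℝ :=
  ∫ ω : Fin n → Fin d → ℝ,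
    (∏ i, f (ω i)) * ∫ s in Sd d, |fhat d n b ω s - f s| ^ p


lemma beta_lint (a c t : ℝ) (ha : 0 < a) (hc : 0 < c) (ht : 0 < t) :
    ∫⁻ x in Set.Ioo 0 t, ENNReal.ofReal (x ^ (a - 1) * (t - x) ^ (c - 1)) =
      ENNReal.ofReal (Real.Gamma a * Real.Gamma c / Real.Gamma (a + c) * t ^ (a + c - 1)) := by
  have himg : (fun y : ℝ => t * y) '' Set.Ioo 0 1 = Set.Ioo 0 t := by
    have := Set.image_mul_left_Ioo ht (0:ℝ) 1
    simpa using this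
  rw [← himg, lintegral_image_eq_lintegral_abs_deriv_mul (f' := fun _ => t) measurableSet_Ioo
    (fun x _ => by simpa using ((hasDerivAt_id x).const_mul t).hasDerivWithinAt)
    (fun x _ y _ h => by simpa [ht.ne'] using h)]
  have h1 := ProbabilityTheory.lintegral_betaPDF_eq_one ha hc
  rw [ProbabilityTheory.lintegral_betaPDF] at h1
  have hB := ProbabilityTheory.beta_pos ha hc
  rw [show Real.Gamma a * Real.Gamma c / Real.Gamma (a + c) = ProbabilityTheory.beta a c from rfl]
  rw [← mul_one (ENNReal.ofReal (ProbabilityTheory.beta a c * _)), ← h1, ← lintegral_const_mul' _ _ ENNReal.ofReal_ne_top]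
  refine setLIntegral_congr_fun (measurableSet_Ioo (a := (0:ℝ)) (b := 1)) fun y hy => ?_
  obtain ⟨h0, h2⟩ := hy
  rw [← ENNReal.ofReal_mul (abs_nonneg _), ← ENNReal.ofReal_mul (by positivity)]
  congr 1
  rw [abs_of_pos ht, show t - t * y = t * (1 - y) by ring, Real.mul_rpow ht.le h0.le,
    Real.mul_rpow ht.le (by linarith), show a + c - 1 = (a - 1) + (c - 1) + 1 by ring,
    Real.rpow_add ht, Real.rpow_add ht, Real.rpow_one]
  field_simp

def dirG (d : ℕ) (u : Fin d → ℝ) (v t : ℝ) : (Fin d → ℝ) → ℝ≥0∞ :=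
  Set.indicator {x | (∀ i, 0 ≤ x i) ∧ ∑ i, x i ≤ t}
    (fun x => ENNReal.ofReal ((t - ∑ i, x i) ^ (v - 1) * ∏ i, (x i) ^ (u i - 1)))

lemma measurableSet_simp (d : ℕ) (t : ℝ) :
    MeasurableSet {x : Fin d → ℝ | (∀ i, 0 ≤ x i) ∧ ∑ i, x i ≤ t} := by
  apply MeasurableSet.inter
  · have : {x : Fin d → ℝ | ∀ i, 0 ≤ x i} = ⋂ i, {x | 0 ≤ x i} := by ext; simp
    change MeasurableSet {x : Fin d → ℝ | ∀ i, 0 ≤ x i}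
    rw [this]
    exact MeasurableSet.iInter fun i => measurableSet_le measurable_const (measurable_pi_apply i)
  · exact measurableSet_le (f := fun x : Fin d → ℝ => ∑ i, x i) (by fun_prop) measurable_const

lemma measurable_dirG (d : ℕ) (u : Fin d → ℝ) (v t : ℝ) : Measurable (dirG d u v t) := by
  refine Measurable.indicator ?_ (measurableSet_simp d t)
  fun_prop

lemma dirG_cons (d : ℕ) (u : Fin (d+1) → ℝ) (v t x : ℝ) (y : Fin d → ℝ) (hx : 0 < x) :
    dirG (d+1) u v t (Fin.cons x y) =
      ENNReal.ofReal (x ^ (u 0 - 1)) * dirG d (fun i => u i.succ) v (t - x) y := by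
  have hm : (Fin.cons x y : Fin (d+1) → ℝ) ∈ {x : Fin (d+1) → ℝ | (∀ i, 0 ≤ x i) ∧ ∑ i, x i ≤ t} ↔
      y ∈ {y : Fin d → ℝ | (∀ i, 0 ≤ y i) ∧ ∑ i, y i ≤ t - x} := by
    simp only [Set.mem_ofPred_eq, Fin.sum_univ_succ, Fin.forall_fin_succ, Fin.cons_zero,
      Fin.cons_succ]
    constructor
    · rintro ⟨⟨_, h1⟩, h2⟩
      exact ⟨h1, by linarith⟩
    · rintro ⟨h1, h2⟩
      exact ⟨⟨hx.le, h1⟩, by linarith⟩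
  unfold dirG
  by_cases h : y ∈ {y : Fin d → ℝ | (∀ i, 0 ≤ y i) ∧ ∑ i, y i ≤ t - x}
  · rw [Set.indicator_of_mem h, Set.indicator_of_mem (hm.2 h)]
    rw [← ENNReal.ofReal_mul (by positivity)]
    congr 1
    simp only [Fin.sum_univ_succ, Fin.prod_univ_succ, Fin.cons_zero, Fin.cons_succ]
    rw [sub_sub]
    ring
  · rw [Set.indicator_of_notMem h, Set.indicator_of_notMem (fun h' => h (hm.1 h')), mul_zero]

lemma dirG_cons_zero (d : ℕ) (u : Fin (d+1) → ℝ) (v t x : ℝ) (y : Fin d → ℝ)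
    (hx : x < 0 ∨ t < x) : dirG (d+1) u v t (Fin.cons x y) = 0 := by
  unfold dirG
  rw [Set.indicator_of_notMem]
  simp only [Set.mem_ofPred_eq, Fin.sum_univ_succ, Fin.forall_fin_succ, Fin.cons_zero, Fin.cons_succ]
  rintro ⟨⟨h0, h1⟩, h2⟩
  have := Finset.sum_nonneg (fun i (_ : i ∈ Finset.univ) => h1 i)
  rcases hx with h | h <;> linarith

lemma lintegral_dirG (d : ℕ) : ∀ (u : Fin d → ℝ) (v t : ℝ), (∀ i, 0 < u i) → 0 < v → 0 < t →
    ∫⁻ x, dirG d u v t x =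
      ENNReal.ofReal ((Real.Gamma v * ∏ i, Real.Gamma (u i)) / Real.Gamma (v + ∑ i, u i) *
        t ^ (v + ∑ i, u i - 1)) := by
  induction d with
  | zero =>
    intro u v t _ hv ht
    have := (Real.Gamma_pos_of_pos hv).ne'
    rw [volume_pi, Measure.pi_of_empty (x := fun i => i.elim0), lintegral_dirac]
    simp [dirG, ht.le, this]
  | succ d ih =>
    intro u v t hu hv ht
    have hU : 0 < v + ∑ i : Fin d, u i.succ := by
      have := Finset.sum_nonneg (fun i (_ : i ∈ Finset.univ) => (hu (Fin.succ i)).le)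
      linarith
    have mp := (volume_preserving_piFinSuccAbove (fun _ : Fin (d+1) => ℝ) 0).symm
    rw [← mp.lintegral_comp (measurable_dirG _ _ _ _), Measure.volume_eq_prod,
      lintegral_prod (fun z => dirG (d + 1) u v t
        ((MeasurableEquiv.piFinSuccAbove (fun x => ℝ) 0).symm z))
        ((measurable_dirG _ _ _ _).comp mp.measurable).aemeasurable]
    have key : ∀ x ∈ Set.Ioo 0 t, ∫⁻ y, dirG (d+1) u v t
        ((MeasurableEquiv.piFinSuccAbove (fun _ : Fin (d+1) => ℝ) 0).symm (x, y)) =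
        ENNReal.ofReal ((Real.Gamma v * ∏ i : Fin d, Real.Gamma (u i.succ)) /
            Real.Gamma (v + ∑ i : Fin d, u i.succ)) *
          ENNReal.ofReal (x ^ (u 0 - 1) * (t - x) ^ (v + ∑ i : Fin d, u i.succ - 1)) := by
      intro x hx
      have : ∀ y : Fin d → ℝ, (MeasurableEquiv.piFinSuccAbove (fun _ : Fin (d+1) => ℝ) 0).symm (x, y)
          = Fin.cons x y := by
        intro y; simp [MeasurableEquiv.piFinSuccAbove]; rfl
      simp_rw [this, dirG_cons d u v t x _ hx.1]
      rw [lintegral_const_mul' _ _ ENNReal.ofReal_ne_top,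
        ih _ v (t - x) (fun i => hu _) hv (by linarith [hx.2]),
        ← ENNReal.ofReal_mul (by have := hx.1; positivity), ← ENNReal.ofReal_mul]
      · congr 1; ring
      · have h1 := Real.Gamma_pos_of_pos hv
        have h2 := Real.Gamma_pos_of_pos hU
        have h3 := Finset.prod_pos (fun i (_ : i ∈ Finset.univ) =>
          Real.Gamma_pos_of_pos (hu (Fin.succ i)))
        positivity
    have : ∫⁻ x, ∫⁻ y, dirG (d+1) u v t
        ((MeasurableEquiv.piFinSuccAbove (fun _ : Fin (d+1) => ℝ) 0).symm (x, y)) =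
        ∫⁻ x in Set.Ioo 0 t, ∫⁻ y, dirG (d+1) u v t
        ((MeasurableEquiv.piFinSuccAbove (fun _ : Fin (d+1) => ℝ) 0).symm (x, y)) := by
      rw [setLIntegral_congr (Ioo_ae_eq_Icc (μ := volume) (a := (0:ℝ)) (b := t)),
        ← lintegral_indicator measurableSet_Icc]
      congr 1; ext x
      by_cases hx : x ∈ Set.Icc 0 t
      · rw [Set.indicator_of_mem hx]
      · rw [Set.indicator_of_notMem hx]
        have hx' : x < 0 ∨ t < x := by
          by_contra hcon; push Not at hcon; exact hx hcon
        have : ∀ y : Fin d → ℝ,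
          (MeasurableEquiv.piFinSuccAbove (fun _ : Fin (d+1) => ℝ) 0).symm (x, y)
          = Fin.cons x y := by
          intro y; simp [MeasurableEquiv.piFinSuccAbove]; rfl
        simp_rw [this, dirG_cons_zero d u v t x _ hx']
        simp
    rw [this, setLIntegral_congr_fun measurableSet_Ioo key,
      lintegral_const_mul' _ _ ENNReal.ofReal_ne_top, beta_lint _ _ _ (hu 0) hU ht]
    have h1 := Real.Gamma_pos_of_pos hv
    have h2 := Real.Gamma_pos_of_pos hU
    have h3 := Finset.prod_pos (fun i (_ : i ∈ Finset.univ) =>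
          Real.Gamma_pos_of_pos (hu (Fin.succ i)))
    rw [← ENNReal.ofReal_mul (by positivity)]
    congr 1
    rw [Fin.sum_univ_succ, Fin.prod_univ_succ,
      show v + (u 0 + ∑ i : Fin d, u i.succ) = u 0 + (v + ∑ i : Fin d, u i.succ) by ring]
    field_simp


lemma Sd_eq (d : ℕ) : Sd d = {x : Fin d → ℝ | (∀ i, 0 ≤ x i) ∧ ∑ i, x i ≤ 1} := by
  ext x
  simp only [Sd, Set.mem_ofPred_eq]
  constructor
  · rintro ⟨h1, h2⟩; exact ⟨fun i => (h1 i).1, h2⟩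
  · rintro ⟨h1, h2⟩
    exact ⟨fun i => ⟨h1 i, (Finset.single_le_sum (fun j _ => h1 j) (Finset.mem_univ i)).trans h2⟩, h2⟩

lemma measurableSet_Sd (d : ℕ) : MeasurableSet (Sd d) := by
  rw [Sd_eq]; exact measurableSet_simp d 1

lemma dirK_nonneg (d : ℕ) (u : Fin d → ℝ) (v : ℝ) (hu : ∀ i, 0 < u i) (hv : 0 < v)
    (x : Fin d → ℝ) : 0 ≤ dirK d u v x := by
  unfold dirK
  refine Set.indicator_nonneg (fun s hs => ?_) x
  rw [Sd_eq] at hs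
  have h1 := Real.Gamma_pos_of_pos hv
  have h3 := Finset.prod_pos (fun i (_ : i ∈ Finset.univ) => Real.Gamma_pos_of_pos (hu i))
  have hU : 0 < v + ∑ i, u i := by
    have := Finset.sum_nonneg (fun i (_ : i ∈ Finset.univ) => (hu i).le)
    linarith
  have h2 := Real.Gamma_pos_of_pos hU
  have h4 : 0 ≤ (1 - ∑ i, s i) ^ (v - 1) := Real.rpow_nonneg (by linarith [hs.2]) _
  have h5 : 0 ≤ ∏ i, (s i) ^ (u i - 1) :=
    Finset.prod_nonneg fun i _ => Real.rpow_nonneg (hs.1 i) _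
  positivity

lemma measurable_dirK (d : ℕ) (u : Fin d → ℝ) (v : ℝ) : Measurable (dirK d u v) := by
  refine Measurable.indicator ?_ (measurableSet_Sd d)
  fun_prop

lemma lintegral_dirK (d : ℕ) (u : Fin d → ℝ) (v : ℝ) (hu : ∀ i, 0 < u i) (hv : 0 < v) :
    ∫⁻ x, ENNReal.ofReal (dirK d u v x) = 1 := by
  have h1 := Real.Gamma_pos_of_pos hv
  have h3 := Finset.prod_pos (fun i (_ : i ∈ Finset.univ) => Real.Gamma_pos_of_pos (hu i))
  have hU : 0 < v + ∑ i, u i := by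
    have := Finset.sum_nonneg (fun i (_ : i ∈ Finset.univ) => (hu i).le)
    linarith
  have h2 := Real.Gamma_pos_of_pos hU
  have : ∀ x, ENNReal.ofReal (dirK d u v x) =
      ENNReal.ofReal (Real.Gamma (v + ∑ i, u i) / (Real.Gamma v * ∏ i, Real.Gamma (u i))) *
        dirG d u v 1 x := by
    intro x
    unfold dirK dirG
    rw [← Sd_eq]
    by_cases hx : x ∈ Sd d
    · rw [Set.indicator_of_mem hx, Set.indicator_of_mem hx, ← ENNReal.ofReal_mul (by positivity)]
      congr 1; ring
    · rw [Set.indicator_of_notMem hx, Set.indicator_of_notMem hx]; simp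
  simp_rw [this]
  rw [lintegral_const_mul' _ _ ENNReal.ofReal_ne_top, lintegral_dirG d u v 1 hu hv one_pos,
    ← ENNReal.ofReal_mul (by positivity), Real.one_rpow, mul_one, ← ENNReal.ofReal_one]
  congr 1
  field_simp

lemma integrable_dirK (d : ℕ) (u : Fin d → ℝ) (v : ℝ) (hu : ∀ i, 0 < u i) (hv : 0 < v) :
    Integrable (dirK d u v) := by
  refine ⟨(measurable_dirK d u v).aestronglyMeasurable, ?_⟩
  rw [hasFiniteIntegral_iff_ofReal (Eventually.of_forall (dirK_nonneg d u v hu hv)),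
    lintegral_dirK d u v hu hv]
  exact ENNReal.one_lt_top

lemma integral_dirK (d : ℕ) (u : Fin d → ℝ) (v : ℝ) (hu : ∀ i, 0 < u i) (hv : 0 < v) :
    ∫ x, dirK d u v x = 1 := by
  rw [integral_eq_lintegral_of_nonneg_ae (Eventually.of_forall (dirK_nonneg d u v hu hv))
    (measurable_dirK d u v).aestronglyMeasurable, lintegral_dirK d u v hu hv]
  simp

lemma mul_dirK (d : ℕ) (u : Fin d → ℝ) (v : ℝ) (hu : ∀ i, 1 ≤ u i) (hv : 0 < v) (j : Fin d)
    (x : Fin d → ℝ) : x j * dirK d u v x =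
      u j / (v + ∑ i, u i) * dirK d (u + Pi.single j 1 : Fin d → ℝ) v x := by
  unfold dirK
  by_cases hx : x ∈ Sd d
  · rw [Set.indicator_of_mem hx, Set.indicator_of_mem hx]
    rw [Sd_eq] at hx
    have hu' : ∀ i, 0 < u i := fun i => by linarith [hu i]
    have h1 := Real.Gamma_pos_of_pos hv
    have h3 := fun i => Real.Gamma_pos_of_pos (hu' i)
    have hU : 0 < v + ∑ i, u i := by
      have := Finset.sum_nonneg (fun i (_ : i ∈ Finset.univ) => (hu' i).le)
      linarith
    have h2 := Real.Gamma_pos_of_pos hU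
    have e1 : v + ∑ i, (u + Pi.single j 1 : Fin d → ℝ) i = v + ∑ i, u i + 1 := by
      simp [Finset.sum_add_distrib, add_assoc]
    have e2 : ∏ i, Real.Gamma ((u + Pi.single j 1 : Fin d → ℝ) i) = u j * ∏ i, Real.Gamma (u i) := by
      rw [← Finset.mul_prod_erase _ _ (Finset.mem_univ j),
        ← Finset.mul_prod_erase _ (fun i => Real.Gamma (u i)) (Finset.mem_univ j)]
      rw [Finset.prod_congr (g := fun i => Real.Gamma (u i)) rfl]
      · simp only [Pi.add_apply, Pi.single_eq_same]
        rw [Real.Gamma_add_one (hu' j).ne']; ring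
      · intro i hi
        simp [Pi.single_eq_of_ne (Finset.ne_of_mem_erase hi)]
    have e3 : ∏ i, (x i) ^ ((u + Pi.single j 1 : Fin d → ℝ) i - 1) = x j * ∏ i, (x i) ^ (u i - 1) := by
      rw [← Finset.mul_prod_erase _ _ (Finset.mem_univ j),
        ← Finset.mul_prod_erase _ (fun i => (x i) ^ (u i - 1)) (Finset.mem_univ j)]
      rw [Finset.prod_congr (g := fun i => (x i) ^ (u i - 1)) rfl]
      · simp only [Pi.add_apply, Pi.single_eq_same]
        rw [show u j + 1 - 1 = (u j - 1) + 1 by ring,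
          Real.rpow_add_one' (hx.1 j) (by linarith [hu j])]; ring
      · intro i hi
        simp [Pi.single_eq_of_ne (Finset.ne_of_mem_erase hi)]
    rw [e1, e2, e3, Real.Gamma_add_one hU.ne']
    have h5 := Finset.prod_pos (fun i (_ : i ∈ Finset.univ) => h3 i)
    have := hu' j
    field_simp
  · rw [Set.indicator_of_notMem hx, Set.indicator_of_notMem hx]; simp

lemma shift_ge (d : ℕ) (u : Fin d → ℝ) (hu : ∀ i, 1 ≤ u i) (j i : Fin d) :
    1 ≤ (u + Pi.single j 1 : Fin d → ℝ) i := by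
  by_cases h : i = j
  · subst h; simp; linarith [hu i]
  · simp [Pi.single_eq_of_ne h, hu i]

lemma integrable_mul_dirK (d : ℕ) (u : Fin d → ℝ) (v : ℝ) (hu : ∀ i, 1 ≤ u i) (hv : 0 < v)
    (j : Fin d) : Integrable (fun x => x j * dirK d u v x) := by
  simp_rw [mul_dirK d u v hu hv j]
  exact (integrable_dirK d _ v (fun i => by linarith [shift_ge d u hu j i]) hv).const_mul _

lemma integral_mul_dirK (d : ℕ) (u : Fin d → ℝ) (v : ℝ) (hu : ∀ i, 1 ≤ u i) (hv : 0 < v)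
    (j : Fin d) : ∫ x, x j * dirK d u v x = u j / (v + ∑ i, u i) := by
  simp_rw [mul_dirK d u v hu hv j]
  rw [integral_const_mul, integral_dirK d _ v (fun i => by linarith [shift_ge d u hu j i]) hv, mul_one]

lemma integrable_sq_dirK (d : ℕ) (u : Fin d → ℝ) (v : ℝ) (hu : ∀ i, 1 ≤ u i) (hv : 0 < v)
    (j : Fin d) : Integrable (fun x => x j ^ 2 * dirK d u v x) := by
  have e : ∀ x : Fin d → ℝ, x j ^ 2 * dirK d u v x = u j / (v + ∑ i, u i) *
      (x j * dirK d (u + Pi.single j 1 : Fin d → ℝ) v x) := by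
    intro x; rw [pow_two, mul_assoc, mul_dirK d u v hu hv j]; ring
  simp_rw [e]
  exact (integrable_mul_dirK d _ v (shift_ge d u hu j) hv j).const_mul _

lemma integral_sq_dirK (d : ℕ) (u : Fin d → ℝ) (v : ℝ) (hu : ∀ i, 1 ≤ u i) (hv : 0 < v)
    (j : Fin d) : ∫ x, x j ^ 2 * dirK d u v x =
      u j / (v + ∑ i, u i) * ((u j + 1) / (v + ∑ i, u i + 1)) := by
  have e : ∀ x : Fin d → ℝ, x j ^ 2 * dirK d u v x = u j / (v + ∑ i, u i) *
      (x j * dirK d (u + Pi.single j 1 : Fin d → ℝ) v x) := by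
    intro x; rw [pow_two, mul_assoc, mul_dirK d u v hu hv j]; ring
  simp_rw [e]
  rw [integral_const_mul, integral_mul_dirK d _ v (shift_ge d u hu j) hv j]
  simp [Finset.sum_add_distrib, add_assoc]


/-- The test density, proportional to the coordinate `x j` on the simplex. -/
def f0 (d : ℕ) (j : Fin d) : (Fin d → ℝ) → ℝ := dirK d (1 + Pi.single j 1 : Fin d → ℝ) 1

def Cf (d : ℕ) : ℝ := (1 + d) * Real.Gamma (1 + d)

lemma Cf_pos (d : ℕ) : 0 < Cf d := by
  unfold Cf
  have : 0 < Real.Gamma (1 + d) := Real.Gamma_pos_of_pos (by positivity)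
  positivity

lemma f0_eq (d : ℕ) (j : Fin d) (x : Fin d → ℝ) (hx : x ∈ Sd d) : f0 d j x = Cf d * x j := by
  have h := mul_dirK d (1 : Fin d → ℝ) 1 (fun i => le_rfl) one_pos j x
  have h2 : dirK d (1 : Fin d → ℝ) 1 x = Real.Gamma (1 + d) := by
    unfold dirK
    rw [Set.indicator_of_mem hx]
    simp
  rw [h2] at h
  simp at h
  unfold f0 Cf
  have : (0:ℝ) < 1 + d := by positivity
  rw [mul_assoc, mul_comm (Real.Gamma _), h]
  field_simp

lemma f0_notMem (d : ℕ) (j : Fin d) (x : Fin d → ℝ) (hx : x ∉ Sd d) : f0 d j x = 0 := by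
  unfold f0 dirK
  rw [Set.indicator_of_notMem hx]

lemma f0_nonneg (d : ℕ) (j : Fin d) (x : Fin d → ℝ) : 0 ≤ f0 d j x :=
  dirK_nonneg _ _ _ (fun i => by linarith [shift_ge d 1 (fun i => le_rfl) j i]) one_pos x

lemma measurable_f0 (d : ℕ) (j : Fin d) : Measurable (f0 d j) := measurable_dirK _ _ _

lemma integrable_f0 (d : ℕ) (j : Fin d) : Integrable (f0 d j) :=
  integrable_dirK _ _ _ (fun i => by linarith [shift_ge d 1 (fun i => le_rfl) j i]) one_pos

lemma integral_f0 (d : ℕ) (j : Fin d) : ∫ x, f0 d j x = 1 :=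
  integral_dirK _ _ _ (fun i => by linarith [shift_ge d 1 (fun i => le_rfl) j i]) one_pos

lemma lintegral_f0 (d : ℕ) (j : Fin d) : ∫⁻ x, ENNReal.ofReal (f0 d j x) = 1 :=
  lintegral_dirK _ _ _ (fun i => by linarith [shift_ge d 1 (fun i => le_rfl) j i]) one_pos

lemma f0_le (d : ℕ) (j : Fin d) (x : Fin d → ℝ) : f0 d j x ≤ Cf d := by
  have := Cf_pos d
  by_cases hx : x ∈ Sd d
  · rw [f0_eq d j x hx]
    nlinarith [(hx.1 j).2]
  · rw [f0_notMem d j x hx]; exact this.le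

lemma f0_mem (d : ℕ) (j : Fin d) (β L : ℝ) (hβ : 2 < β) (hL : 0 < L) :
    f0 d j ∈ holderClass d β L := by
  have hm : 2 ≤ mOf β := by
    unfold mOf
    have : 2 < ⌈β⌉₊ := by rw [Nat.lt_ceil]; exact_mod_cast hβ
    omega
  have hEq : Set.EqOn (f0 d j) (fun x => (Cf d • ContinuousLinearMap.proj (R := ℝ) (φ := fun _ : Fin d => ℝ) j) x)
      (interior (Sd d)) := by
    intro x hx
    rw [f0_eq d j x (interior_subset hx)]
    simp
  refine ⟨f0_nonneg d j, f0_notMem d j, ?_, ?_, ?_⟩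
  · rw [setIntegral_eq_integral_of_forall_compl_eq_zero (f0_notMem d j), integral_f0]
  · exact (ContinuousLinearMap.contDiff _).contDiffOn.congr hEq
  · have hz : ∀ v : Fin (mOf β) → Fin d, ∀ s ∈ interior (Sd d),
        Dpartial d (mOf β) (f0 d j) v s = 0 := by
      intro v s hs
      unfold Dpartial
      rw [iteratedFDerivWithin_congr hEq hs]
      obtain ⟨k, hk⟩ : ∃ k, mOf β = k + 1 + 1 := ⟨mOf β - 2, by omega⟩
      have : ∀ m : ℕ, m = k + 1 + 1 → ∀ w : Fin m → (Fin d → ℝ), iteratedFDerivWithin ℝ m (fun x => (Cf d • ContinuousLinearMap.proj (R := ℝ) (φ := fun _ : Fin d => ℝ) j) x) (interior (Sd d)) s w = 0 := by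
        rintro m rfl w
        rw [iteratedFDerivWithin_succ_apply_right isOpen_interior.uniqueDiffOn hs]
        have hc : Set.EqOn (fderivWithin ℝ (fun x => (Cf d • ContinuousLinearMap.proj (R := ℝ) (φ := fun _ : Fin d => ℝ) j) x) (interior (Sd d)))
            (fun _ => Cf d • ContinuousLinearMap.proj (R := ℝ) (φ := fun _ : Fin d => ℝ) j) (interior (Sd d)) := by
          intro y hy
          exact ContinuousLinearMap.fderivWithin _ (isOpen_interior.uniqueDiffWithinAt hy)
        rw [iteratedFDerivWithin_congr hc hs, iteratedFDerivWithin_const_of_ne (Nat.succ_ne_zero k)]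
        simp
      exact this _ hk _
    intro v s hs t ht
    rw [hz v s hs, hz v t ht]
    simp
    have : 0 ≤ ∑ i, |s i - t i| := Finset.sum_nonneg fun i _ => abs_nonneg _
    positivity

/-! Moments of the kernel -/

lemma par_u (d : ℕ) (b : ℝ) (hb : 0 < b) (s : Fin d → ℝ) (hs : s ∈ Sd d) (i : Fin d) :
    1 ≤ s i / b + 1 := by
  have := (hs.1 i).1
  have : 0 ≤ s i / b := by positivity
  linarith

lemma par_v (d : ℕ) (b : ℝ) (hb : 0 < b) (s : Fin d → ℝ) (hs : s ∈ Sd d) :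
    1 ≤ (1 - ∑ i, s i) / b + 1 := by
  have h := hs.2
  have : 0 ≤ (1 - ∑ i, s i) / b := div_nonneg (by linarith) hb.le
  linarith

lemma par_sum (d : ℕ) (b : ℝ) (hb : 0 < b) (s : Fin d → ℝ) :
    (1 - ∑ i, s i) / b + 1 + ∑ i, (s i / b + 1) = (1 + (d + 1) * b) / b := by
  rw [Finset.sum_add_distrib, ← Finset.sum_div]
  simp
  field_simp
  ring

lemma dirKb_nonneg (d : ℕ) (b : ℝ) (hb : 0 < b) (s : Fin d → ℝ) (hs : s ∈ Sd d) (x : Fin d → ℝ) :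
    0 ≤ dirKb d b s x :=
  dirK_nonneg _ _ _ (fun i => by linarith [par_u d b hb s hs i]) (by linarith [par_v d b hb s hs]) x

lemma dirKb_notMem (d : ℕ) (b : ℝ) (s : Fin d → ℝ) (x : Fin d → ℝ) (hx : x ∉ Sd d) :
    dirKb d b s x = 0 := by
  unfold dirKb dirK
  rw [Set.indicator_of_notMem hx]

lemma measurable_dirKb (d : ℕ) (b : ℝ) (s : Fin d → ℝ) : Measurable (dirKb d b s) :=
  measurable_dirK _ _ _

lemma integrable_dirKb (d : ℕ) (b : ℝ) (hb : 0 < b) (s : Fin d → ℝ) (hs : s ∈ Sd d) :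
    Integrable (dirKb d b s) :=
  integrable_dirK _ _ _ (fun i => by linarith [par_u d b hb s hs i])
    (by linarith [par_v d b hb s hs])

lemma integral_dirKb (d : ℕ) (b : ℝ) (hb : 0 < b) (s : Fin d → ℝ) (hs : s ∈ Sd d) :
    ∫ x, dirKb d b s x = 1 :=
  integral_dirK _ _ _ (fun i => by linarith [par_u d b hb s hs i])
    (by linarith [par_v d b hb s hs])

lemma integrable_mul_dirKb (d : ℕ) (b : ℝ) (hb : 0 < b) (s : Fin d → ℝ) (hs : s ∈ Sd d)
    (j : Fin d) : Integrable (fun x => x j * dirKb d b s x) :=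
  integrable_mul_dirK _ _ _ (par_u d b hb s hs) (by linarith [par_v d b hb s hs]) j

lemma integrable_sq_dirKb (d : ℕ) (b : ℝ) (hb : 0 < b) (s : Fin d → ℝ) (hs : s ∈ Sd d)
    (j : Fin d) : Integrable (fun x => x j ^ 2 * dirKb d b s x) :=
  integrable_sq_dirK _ _ _ (par_u d b hb s hs) (by linarith [par_v d b hb s hs]) j

lemma integral_mul_dirKb (d : ℕ) (b : ℝ) (hb : 0 < b) (s : Fin d → ℝ) (hs : s ∈ Sd d)
    (j : Fin d) : ∫ x, x j * dirKb d b s x = (s j + b) / (1 + (d + 1) * b) := by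
  unfold dirKb
  rw [integral_mul_dirK _ _ _ (par_u d b hb s hs) (by linarith [par_v d b hb s hs]) j,
    par_sum d b hb]
  have : 0 < 1 + (d + 1) * b := by positivity
  field_simp

lemma integral_sq_dirKb (d : ℕ) (b : ℝ) (hb : 0 < b) (s : Fin d → ℝ) (hs : s ∈ Sd d)
    (j : Fin d) : ∫ x, x j ^ 2 * dirKb d b s x =
      (s j + b) / (1 + (d + 1) * b) * ((s j + 2 * b) / (1 + (d + 2) * b)) := by
  unfold dirKb
  rw [integral_sq_dirK _ _ _ (par_u d b hb s hs) (by linarith [par_v d b hb s hs]) j,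
    par_sum d b hb]
  have : 0 < 1 + (d + 1) * b := by positivity
  have : 0 < 1 + (d + 2) * b := by positivity
  have e1 : (1 + (d + 1) * b) / b + 1 = (1 + (d + 2) * b) / b := by field_simp; ring
  have e2 : s j / b + 1 + 1 = (s j + 2 * b) / b := by field_simp; ring
  have e3 : s j / b + 1 = (s j + b) / b := by field_simp
  rw [e1, e2, e3]
  field_simp

lemma integrable_dev_dirKb (d : ℕ) (b : ℝ) (hb : 0 < b) (s : Fin d → ℝ) (hs : s ∈ Sd d)
    (j : Fin d) : Integrable (fun x => (x j - s j) ^ 2 * dirKb d b s x) := by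
  have e : ∀ x : Fin d → ℝ, (x j - s j) ^ 2 * dirKb d b s x = x j ^ 2 * dirKb d b s x
      - 2 * s j * (x j * dirKb d b s x) + s j ^ 2 * dirKb d b s x := fun x => by ring
  simp_rw [e]
  exact ((integrable_sq_dirKb d b hb s hs j).sub
    ((integrable_mul_dirKb d b hb s hs j).const_mul _)).add
    ((integrable_dirKb d b hb s hs).const_mul _)

lemma integral_dev_dirKb (d : ℕ) (b : ℝ) (hb : 0 < b) (s : Fin d → ℝ) (hs : s ∈ Sd d)
    (j : Fin d) : ∫ x, (x j - s j) ^ 2 * dirKb d b s x ≤ (2 * d + 3) * b := by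
  have e : ∀ x : Fin d → ℝ, (x j - s j) ^ 2 * dirKb d b s x = x j ^ 2 * dirKb d b s x
      - 2 * s j * (x j * dirKb d b s x) + s j ^ 2 * dirKb d b s x := fun x => by ring
  simp_rw [e]
  have hi : Integrable (fun x : Fin d → ℝ => x j ^ 2 * dirKb d b s x
      - 2 * s j * (x j * dirKb d b s x)) := (integrable_sq_dirKb d b hb s hs j).sub
    ((integrable_mul_dirKb d b hb s hs j).const_mul _)
  rw [integral_add hi ((integrable_dirKb d b hb s hs).const_mul _),
    integral_sub (integrable_sq_dirKb d b hb s hs j)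
    ((integrable_mul_dirKb d b hb s hs j).const_mul _), integral_const_mul, integral_const_mul,
    integral_dirKb d b hb s hs, integral_mul_dirKb d b hb s hs, integral_sq_dirKb d b hb s hs]
  obtain ⟨h0, h1⟩ := hs.1 j
  set m := (s j + b) / (1 + (d + 1) * b) with hm
  set q := (s j + 2 * b) / (1 + (d + 2) * b) with hq
  have p1 : 0 < 1 + (d + 1) * b := by positivity
  have p2 : 0 < 1 + (d + 2) * b := by positivity
  have hd : (0:ℝ) ≤ d := Nat.cast_nonneg d
  have m0 : 0 ≤ m := by positivity
  have m1 : m ≤ 1 := by rw [hm, div_le_one p1]; nlinarith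
  have hq1 : q - s j ≤ (d + 2) * b := by
    have : q ≤ s j + (d + 2) * b := by
      rw [hq, div_le_iff₀ p2]
      have : 0 ≤ (d+2) * b := by positivity
      nlinarith [mul_nonneg h0 this, mul_nonneg this this]
    linarith
  have hm1 : s j - m ≤ (d + 1) * b := by
    have : s j - (d + 1) * b ≤ m := by
      rw [hm, le_div_iff₀ p1]
      have : 0 ≤ (d+1) * b := by positivity
      nlinarith [mul_nonneg h0 this, mul_nonneg this this]
    linarith
  nlinarith [mul_nonneg m0 (sub_nonneg.2 hq1), mul_nonneg h0 (sub_nonneg.2 hm1),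
    mul_nonneg (sub_nonneg.2 m1) (by positivity : 0 ≤ (d+2) * b),
    mul_nonneg (sub_nonneg.2 h1) (by positivity : 0 ≤ (d+1) * b)]


/-! Pointwise bounds on the kernel -/

def aR (d : ℕ) : ℝ := 1 / (2 * (d + 1))

/-- A box well inside the simplex. -/
def Rbox (d : ℕ) : Set (Fin d → ℝ) := Set.Icc (fun _ => aR d) (fun _ => 3 / 2 * aR d)

lemma aR_pos (d : ℕ) : 0 < aR d := by unfold aR; positivity

lemma aR_le (d : ℕ) (hd : 1 ≤ d) : aR d ≤ 1 / 4 := by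
  have : (1:ℝ) ≤ d := by exact_mod_cast hd
  unfold aR
  rw [div_le_div_iff₀ (by positivity) (by norm_num)]; linarith

lemma Rbox_sum (d : ℕ) (s : Fin d → ℝ) (hs : s ∈ Rbox d) : 1 / 4 ≤ 1 - ∑ i, s i := by
  have h : ∑ i, s i ≤ ∑ _i : Fin d, 3 / 2 * aR d := Finset.sum_le_sum fun i _ => hs.2 i
  simp at h
  have : d * (3 / 2 * aR d) ≤ 3 / 4 := by
    unfold aR
    field_simp
    linarith
  linarith

lemma Rbox_sub (d : ℕ) : Rbox d ⊆ Sd d := by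
  intro s hs
  rw [Sd_eq]
  have := Rbox_sum d s hs
  exact ⟨fun i => (aR_pos d).le.trans (hs.1 i), by linarith⟩

lemma rpow_up (b c y : ℝ) (hb : 0 < b) (hc : 0 < c) (hy : 0 ≤ y) :
    y ^ (c / b) ≤ c ^ (c / b) * Real.exp ((y - c) / b) := by
  have h1 : y / c ≤ Real.exp (y / c - 1) := by
    linarith [Real.add_one_le_exp (y / c - 1)]
  have h2 : (y / c) ^ (c / b) ≤ (Real.exp (y / c - 1)) ^ (c / b) :=
    Real.rpow_le_rpow (by positivity) h1 (by positivity)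
  rw [Real.div_rpow hy hc.le, ← Real.exp_mul, div_le_iff₀ (by positivity),
    show (y / c - 1) * (c / b) = (y - c) / b by field_simp] at h2
  linarith

lemma rpow_lo (b c y : ℝ) (hb : 0 < b) (hc : 0 < c) (h1 : |y - c| ≤ c / 2)
    (h2 : 2 * (y - c) ^ 2 ≤ c * b) :
    c ^ (c / b) * Real.exp ((y - c) / b) * Real.exp (-1) ≤ y ^ (c / b) := by
  obtain ⟨hl, hr⟩ := abs_le.1 h1
  have hy : 0 < y := by linarith
  have h3 : Real.exp (1 - c / y) ≤ y / c := by
    have := Real.add_one_le_exp (c / y - 1)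
    have h4 : c / y ≤ Real.exp (c / y - 1) := by linarith
    rw [show 1 - c / y = -(c / y - 1) by ring, Real.exp_neg]
    calc (Real.exp (c / y - 1))⁻¹ ≤ (c / y)⁻¹ := by
          apply inv_anti₀ (by positivity) h4
      _ = y / c := by rw [inv_div]
  have h5 : (Real.exp (1 - c / y)) ^ (c / b) ≤ (y / c) ^ (c / b) :=
    Real.rpow_le_rpow (by positivity) h3 (by positivity)
  rw [Real.div_rpow hy.le hc.le, ← Real.exp_mul, le_div_iff₀ (by positivity)] at h5
  refine le_trans ?_ h5
  rw [mul_assoc, ← Real.exp_add, mul_comm]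
  refine mul_le_mul_of_nonneg_right (Real.exp_le_exp.2 ?_) (by positivity)
  have e : (1 - c / y) * (c / b) - ((y - c) / b + -1) = (y * b - (y - c) ^ 2) / (y * b) := by
    field_simp; ring
  have : 0 ≤ (y * b - (y - c) ^ 2) / (y * b) := by
    apply div_nonneg _ (by positivity)
    nlinarith
  linarith

/-- The unnormalised kernel. -/
def Hk (d : ℕ) (b : ℝ) (s x : Fin d → ℝ) : ℝ :=
  (1 - ∑ i, x i) ^ ((1 - ∑ i, s i) / b) * ∏ i, (x i) ^ (s i / b)

def Ak (d : ℕ) (b : ℝ) (s : Fin d → ℝ) : ℝ :=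
  Real.Gamma ((1 - ∑ i, s i) / b + 1 + ∑ i, (s i / b + 1)) /
    (Real.Gamma ((1 - ∑ i, s i) / b + 1) * ∏ i, Real.Gamma (s i / b + 1))

lemma dirKb_eq (d : ℕ) (b : ℝ) (s x : Fin d → ℝ) (hx : x ∈ Sd d) :
    dirKb d b s x = Ak d b s * Hk d b s x := by
  unfold dirKb dirK Ak Hk
  rw [Set.indicator_of_mem hx]
  simp only [add_sub_cancel_right]
  ring

lemma Ak_pos (d : ℕ) (b : ℝ) (hb : 0 < b) (s : Fin d → ℝ) (hs : s ∈ Sd d) : 0 < Ak d b s := by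
  unfold Ak
  rw [par_sum d b hb]
  have h1 := Real.Gamma_pos_of_pos (lt_of_lt_of_le one_pos (par_v d b hb s hs))
  have h2 := Finset.prod_pos (fun i (_ : i ∈ Finset.univ) =>
    Real.Gamma_pos_of_pos (lt_of_lt_of_le one_pos (par_u d b hb s hs i)))
  have h3 : 0 < Real.Gamma ((1 + (d + 1) * b) / b) := Real.Gamma_pos_of_pos (by positivity)
  positivity

lemma exp_cancel (d : ℕ) (b : ℝ) (s x : Fin d → ℝ) :
    Real.exp (((1 - ∑ i, x i) - (1 - ∑ i, s i)) / b) * ∏ i, Real.exp ((x i - s i) / b) = 1 := by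
  rw [← Real.exp_sum, ← Real.exp_add, ← Finset.sum_div, Finset.sum_sub_distrib, ← Real.exp_zero]
  congr 1
  ring

lemma Hk_le (d : ℕ) (b : ℝ) (hb : 0 < b) (s x : Fin d → ℝ) (hs : s ∈ Rbox d) (hx : x ∈ Sd d) :
    Hk d b s x ≤ Hk d b s s := by
  have ha := aR_pos d
  have h0 := Rbox_sum d s hs
  have hsi : ∀ i, 0 < s i := fun i => ha.trans_le (hs.1 i)
  have h1 := rpow_up b (1 - ∑ i, s i) (1 - ∑ i, x i) hb (by linarith) (by linarith [hx.2])
  have h2 : ∏ i, (x i) ^ (s i / b) ≤ ∏ i, ((s i) ^ (s i / b) * Real.exp ((x i - s i) / b)) :=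
    Finset.prod_le_prod (fun i _ => Real.rpow_nonneg (hx.1 i).1 _)
      (fun i _ => rpow_up b (s i) (x i) hb (hsi i) (hx.1 i).1)
  rw [Finset.prod_mul_distrib] at h2
  unfold Hk
  calc _ ≤ _ := mul_le_mul h1 h2 (Finset.prod_nonneg fun i _ => Real.rpow_nonneg (hx.1 i).1 _)
        (mul_nonneg (Real.rpow_nonneg (by linarith) _) (Real.exp_pos _).le)
    _ = (1 - ∑ i, s i) ^ ((1 - ∑ i, s i) / b) * (∏ i, (s i) ^ (s i / b)) *
        (Real.exp (((1 - ∑ i, x i) - (1 - ∑ i, s i)) / b) * ∏ i, Real.exp ((x i - s i) / b)) := by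
        ring
    _ = _ := by rw [exp_cancel, mul_one]

lemma Hk_ge (d : ℕ) (hd : 1 ≤ d) (b : ℝ) (hb : 0 < b) (hb1 : b < 1) (s x : Fin d → ℝ)
    (hs : s ∈ Rbox d) (hx : ∀ i, |x i - s i| ≤ aR d * √b / (2 * d)) :
    Real.exp (-1) * Real.exp (-1) ^ d * Hk d b s s ≤ Hk d b s x := by
  have ha := aR_pos d
  have ha4 := aR_le d hd
  have hd1 : (1:ℝ) ≤ d := by exact_mod_cast hd
  have h0 := Rbox_sum d s hs
  have hsi : ∀ i, 0 < s i := fun i => ha.trans_le (hs.1 i)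
  have hq : 0 < √b := Real.sqrt_pos.2 hb
  have hq1 : √b ≤ 1 := Real.sqrt_le_iff.2 ⟨by norm_num, by norm_num; exact hb1.le⟩
  have hqq : √b ^ 2 = b := Real.sq_sqrt hb.le
  have hr : aR d * √b / (2 * d) ≤ aR d * √b / 2 := by
    apply div_le_div_of_nonneg_left (by positivity) (by norm_num); linarith
  have gen : ∀ c y : ℝ, aR d ≤ c → |y - c| ≤ aR d * √b / 2 →
      |y - c| ≤ c / 2 ∧ 2 * (y - c) ^ 2 ≤ c * b := by
    intro c y hc hy
    constructor
    · nlinarith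
    · have : (y - c) ^ 2 ≤ (aR d * √b / 2) ^ 2 := by
        rw [← sq_abs (y - c)]; gcongr
      rw [div_pow, mul_pow, hqq] at this
      nlinarith [mul_pos ha hb]
  have hsum : |(1 - ∑ i, x i) - (1 - ∑ i, s i)| ≤ aR d * √b / 2 := by
    have e : (1 - ∑ i, x i) - (1 - ∑ i, s i) = -∑ i, (x i - s i) := by
      rw [Finset.sum_sub_distrib]; ring
    rw [e, abs_neg]
    calc _ ≤ ∑ i, |x i - s i| := Finset.abs_sum_le_sum_abs _ _
      _ ≤ ∑ _i : Fin d, aR d * √b / (2 * d) := Finset.sum_le_sum fun i _ => hx i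
      _ = _ := by simp; field_simp
  obtain ⟨g1, g2⟩ := gen (1 - ∑ i, s i) (1 - ∑ i, x i) (by linarith) hsum
  have h1 := rpow_lo b (1 - ∑ i, s i) (1 - ∑ i, x i) hb (by linarith) g1 g2
  have h2 : ∏ i, ((s i) ^ (s i / b) * Real.exp ((x i - s i) / b) * Real.exp (-1)) ≤
      ∏ i, (x i) ^ (s i / b) := by
    refine Finset.prod_le_prod (fun i _ => ?_) (fun i _ => ?_)
    · have := Real.rpow_nonneg (hsi i).le (s i / b); positivity
    · obtain ⟨g3, g4⟩ := gen (s i) (x i) (hs.1 i) ((hx i).trans hr)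
      exact rpow_lo b (s i) (x i) hb (hsi i) g3 g4
  rw [Finset.prod_mul_distrib, Finset.prod_mul_distrib, Finset.prod_const, Finset.card_univ,
    Fintype.card_fin] at h2
  have p1 : 0 ≤ (1 - ∑ i, s i) ^ ((1 - ∑ i, s i) / b) := Real.rpow_nonneg (by linarith) _
  have p2 : 0 ≤ ∏ i, (s i) ^ (s i / b) := Finset.prod_nonneg fun i _ => Real.rpow_nonneg (hsi i).le _
  have p3 : 0 ≤ ∏ i, Real.exp ((x i - s i) / b) := Finset.prod_nonneg fun i _ => (Real.exp_pos _).le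
  have p4 : 0 ≤ (1 - ∑ i, x i) ^ ((1 - ∑ i, s i) / b) := le_trans (by positivity) h1
  unfold Hk
  calc _ = (1 - ∑ i, s i) ^ ((1 - ∑ i, s i) / b) * (∏ i, (s i) ^ (s i / b)) *
        Real.exp (-1) * Real.exp (-1) ^ d *
        (Real.exp (((1 - ∑ i, x i) - (1 - ∑ i, s i)) / b) * ∏ i, Real.exp ((x i - s i) / b)) := by
        rw [exp_cancel]; ring
    _ = ((1 - ∑ i, s i) ^ ((1 - ∑ i, s i) / b) *
        Real.exp (((1 - ∑ i, x i) - (1 - ∑ i, s i)) / b) * Real.exp (-1)) *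
        ((∏ i, (s i) ^ (s i / b)) * (∏ i, Real.exp ((x i - s i) / b)) * Real.exp (-1) ^ d) := by
        ring
    _ ≤ _ := mul_le_mul h1 h2 (by positivity) p4

lemma vol_cube (d : ℕ) (s : Fin d → ℝ) (h : ℝ) (hh : 0 ≤ h) :
    volume.real (Set.Icc (fun i => s i - h) (fun i => s i + h)) = (2 * h) ^ d := by
  unfold Measure.real
  rw [Real.volume_Icc_pi_toReal]
  · have : ∀ i, s i + h - (s i - h) = 2 * h := fun i => by ring
    simp [this]
  · intro i; simp; linarith

def CB (d : ℕ) : ℝ := (Real.exp (-1) * Real.exp (-1) ^ d)⁻¹ * ((aR d / d) ^ d)⁻¹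

lemma CB_nonneg (d : ℕ) : 0 ≤ CB d := by
  have := aR_pos d
  unfold CB; positivity

/-- Sup bound of the kernel. -/
lemma dirKb_sup (d : ℕ) (hd : 1 ≤ d) (b : ℝ) (hb : 0 < b) (hb1 : b < 1) (s x : Fin d → ℝ)
    (hs : s ∈ Rbox d) : dirKb d b s x ≤ CB d * (√b ^ d)⁻¹ := by
  have ha := aR_pos d
  have ha4 := aR_le d hd
  have hd1 : (1:ℝ) ≤ d := by exact_mod_cast hd
  have hsS := Rbox_sub d hs
  have hq : 0 < √b := Real.sqrt_pos.2 hb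
  have hq1 : √b ≤ 1 := Real.sqrt_le_iff.2 ⟨by norm_num, by norm_num; exact hb1.le⟩
  have hA := Ak_pos d b hb s hsS
  by_cases hx : x ∈ Sd d
  swap
  · rw [dirKb_notMem d b s x hx]
    have := CB_nonneg d
    positivity
  rw [dirKb_eq d b s x hx]
  refine (mul_le_mul_of_nonneg_left (Hk_le d b hb s x hs hx) hA.le).trans ?_
  set h := aR d * √b / (2 * d) with hh
  have hh0 : 0 < h := by positivity
  set Q := Set.Icc (fun i => s i - h) (fun i => s i + h) with hQ
  have hQS : ∀ y ∈ Q, y ∈ Sd d ∧ ∀ i, |y i - s i| ≤ h := by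
    intro y hy
    have hyi : ∀ i, |y i - s i| ≤ h := fun i => by
      rw [abs_le]; constructor <;> linarith [hy.1 i, hy.2 i]
    refine ⟨?_, hyi⟩
    have hdh : d * h ≤ 1 / 8 := by
      rw [hh]; field_simp; nlinarith
    have hha : h ≤ aR d := by
      rw [hh, div_le_iff₀ (by positivity)]; nlinarith
    rw [Sd_eq]
    refine ⟨fun i => ?_, ?_⟩
    · have := hy.1 i; have := hs.1 i; simp at *; linarith
    · have h1 : ∑ i, y i ≤ ∑ i, (s i + h) := Finset.sum_le_sum fun i _ => hy.2 i
      rw [Finset.sum_add_distrib] at h1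
      simp at h1
      linarith [Rbox_sum d s hs]
  set κ := Real.exp (-1) * Real.exp (-1) ^ d with hκ
  have hκ0 : 0 < κ := by positivity
  have hlow : (Ak d b s * (κ * Hk d b s s)) * volume.real Q ≤ 1 := by
    rw [← integral_dirKb d b hb s hsS]
    calc _ = ∫ _y in Q, Ak d b s * (κ * Hk d b s s) := by
          rw [setIntegral_const]; simp; ring
      _ ≤ ∫ y in Q, dirKb d b s y := by
          refine setIntegral_mono_on ?_ (integrable_dirKb d b hb s hsS).integrableOn
            measurableSet_Icc ?_
          · rw [integrableOn_const_iff]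
            right; exact isCompact_Icc.measure_lt_top
          · intro y hy
            obtain ⟨y1, y2⟩ := hQS y hy
            rw [dirKb_eq d b s y y1]
            exact mul_le_mul_of_nonneg_left (Hk_ge d hd b hb hb1 s y hs y2) hA.le
      _ ≤ ∫ y, dirKb d b s y :=
          setIntegral_le_integral (integrable_dirKb d b hb s hsS)
            (Eventually.of_forall (dirKb_nonneg d b hb s hsS))
  rw [hQ, vol_cube d s h hh0.le] at hlow
  have e : (2 * h) ^ d = (aR d / d) ^ d * √b ^ d := by
    rw [← mul_pow]; congr 1; rw [hh]; field_simp
  rw [e] at hlow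
  unfold CB
  rw [← hκ]
  have pos1 : 0 < (aR d / d) ^ d := by positivity
  have pos2 : 0 < √b ^ d := by positivity
  rw [← mul_inv, ← mul_inv, ← one_div, le_div_iff₀ (by positivity)]
  linarith


def Mc (d : ℕ) : ℝ := √(2 * d * (2 * d + 3))

def clo (d : ℕ) : ℝ := Cf d * aR d / (8 * (2 * Mc d) ^ d)

lemma Mc_pos (d : ℕ) (hd : 1 ≤ d) : 0 < Mc d := by
  have : (0:ℝ) < d := by exact_mod_cast hd
  unfold Mc; positivity

lemma clo_pos (d : ℕ) (hd : 1 ≤ d) : 0 < clo d := by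
  have := Mc_pos d hd
  have := Cf_pos d
  have := aR_pos d
  unfold clo; positivity

/-- Half of the kernel mass lies in a cube of side of order `√b`. -/
lemma mass_cube (d : ℕ) (hd : 1 ≤ d) (b : ℝ) (hb : 0 < b) (s : Fin d → ℝ) (hs : s ∈ Sd d) :
    1 / 2 ≤ ∫ x in Set.Icc (fun i => s i - Mc d * √b) (fun i => s i + Mc d * √b), dirKb d b s x := by
  have hM := Mc_pos d hd
  have hd1 : (1:ℝ) ≤ d := by exact_mod_cast hd
  have hq : 0 < √b := Real.sqrt_pos.2 hb
  set h := Mc d * √b with hh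
  have hh2 : h ^ 2 = 2 * d * (2 * d + 3) * b := by
    rw [hh, mul_pow, Real.sq_sqrt hb.le, Mc, Real.sq_sqrt (by positivity)]
  have hh0 : 0 < h := by positivity
  set Q := Set.Icc (fun i => s i - h) (fun i => s i + h) with hQ
  have hI : Integrable (fun x => ∑ i, (h ^ 2)⁻¹ * ((x i - s i) ^ 2 * dirKb d b s x)) :=
    integrable_finsetSum _ fun i _ => (integrable_dev_dirKb d b hb s hs i).const_mul _
  have hpt : ∀ x, dirKb d b s x - ∑ i, (h ^ 2)⁻¹ * ((x i - s i) ^ 2 * dirKb d b s x) ≤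
      Q.indicator (dirKb d b s) x := by
    intro x
    have hK := dirKb_nonneg d b hb s hs x
    have hnn : ∀ i, 0 ≤ (h ^ 2)⁻¹ * ((x i - s i) ^ 2 * dirKb d b s x) := fun i => by positivity
    by_cases hx : x ∈ Q
    · rw [Set.indicator_of_mem hx]
      linarith [Finset.sum_nonneg fun i (_ : i ∈ Finset.univ) => hnn i]
    · rw [Set.indicator_of_notMem hx]
      have : ∃ i, h < |x i - s i| := by
        by_contra hcon
        push Not at hcon
        apply hx
        constructor <;> intro i <;> have := abs_le.1 (hcon i) <;> simp <;> linarith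
      obtain ⟨i, hi⟩ := this
      have h1 := Finset.single_le_sum (fun i _ => hnn i) (Finset.mem_univ i)
      have h2 : h ^ 2 ≤ (x i - s i) ^ 2 := by rw [← sq_abs (x i - s i)]; gcongr
      have h3 : dirKb d b s x ≤ (h ^ 2)⁻¹ * ((x i - s i) ^ 2 * dirKb d b s x) := by
        rw [← mul_assoc, inv_mul_eq_div]
        have : 1 ≤ (x i - s i) ^ 2 / h ^ 2 := by rwa [le_div_iff₀ (by positivity), one_mul]
        nlinarith
      linarith
  rw [← integral_indicator measurableSet_Icc]
  have hmono := integral_mono ((integrable_dirKb d b hb s hs).sub hI)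
    ((integrable_dirKb d b hb s hs).indicator (measurableSet_Icc : MeasurableSet Q)) hpt
  refine le_trans ?_ hmono
  have e1 : ∫ x, (dirKb d b s - fun x => ∑ i, (h ^ 2)⁻¹ * ((x i - s i) ^ 2 * dirKb d b s x)) x =
      1 - ∑ i, (h ^ 2)⁻¹ * ∫ x, ((x i - s i) ^ 2 * dirKb d b s x) := by
    rw [integral_sub' (integrable_dirKb d b hb s hs) hI, integral_dirKb d b hb s hs,
      integral_finsetSum _ fun i _ => (integrable_dev_dirKb d b hb s hs i).const_mul _]
    simp_rw [integral_const_mul]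
  rw [e1]
  have : ∑ i, (h ^ 2)⁻¹ * ∫ x, ((x i - s i) ^ 2 * dirKb d b s x) ≤
      ∑ _i : Fin d, (h ^ 2)⁻¹ * ((2 * d + 3) * b) :=
    Finset.sum_le_sum fun i _ => mul_le_mul_of_nonneg_left (integral_dev_dirKb d b hb s hs i)
      (by positivity)
  have e2 : ∑ _i : Fin d, (h ^ 2)⁻¹ * ((2 * d + 3) * b) = 1 / 2 := by
    rw [hh2]; simp; field_simp
  linarith

lemma integrable_K2f (d : ℕ) (hd : 1 ≤ d) (b : ℝ) (hb : 0 < b) (hb1 : b < 1) (s : Fin d → ℝ)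
    (hs : s ∈ Rbox d) (j : Fin d) : Integrable (fun x => dirKb d b s x ^ 2 * f0 d j x) := by
  refine (integrable_f0 d j).bdd_mul (c := (CB d * (√b ^ d)⁻¹) ^ 2) ?_ ?_
  · exact ((measurable_dirKb d b s).pow_const 2).aestronglyMeasurable
  · refine Eventually.of_forall fun x => ?_
    have := dirKb_nonneg d b hb s (Rbox_sub d hs) x
    rw [Real.norm_of_nonneg (by positivity)]
    exact pow_le_pow_left₀ this (dirKb_sup d hd b hb hb1 s x hs) 2

lemma second_lo (d : ℕ) (hd : 1 ≤ d) (b : ℝ) (hb : 0 < b) (hb1 : b < 1) (s : Fin d → ℝ)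
    (hs : s ∈ Rbox d) (j : Fin d) (hb2 : Mc d * √b ≤ aR d / 2) :
    clo d * (√b ^ d)⁻¹ ≤ ∫ x, dirKb d b s x ^ 2 * f0 d j x := by
  have hM := Mc_pos d hd
  have hq : 0 < √b := Real.sqrt_pos.2 hb
  have ha := aR_pos d
  have hC := Cf_pos d
  have hsS := Rbox_sub d hs
  have hmass := mass_cube d hd b hb s hsS
  set h := Mc d * √b with hh
  have hh0 : 0 < h := by positivity
  set Q := Set.Icc (fun i => s i - h) (fun i => s i + h) with hQ
  have hvol : volume.real Q = (2 * h) ^ d := vol_cube d s h hh0.le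
  set V := (2 * h) ^ d with hV
  have hV0 : 0 < V := by positivity
  set lam := 1 / (2 * V) with hlam
  have hlam0 : 0 < lam := by positivity
  have hpt : ∀ x ∈ Q, Cf d * aR d / 2 * (2 * lam * dirKb d b s x - lam ^ 2) ≤
      dirKb d b s x ^ 2 * f0 d j x := by
    intro x hx
    have hK := dirKb_nonneg d b hb s hsS x
    by_cases hxS : x ∈ Sd d
    · rw [f0_eq d j x hxS]
      have hxj : aR d / 2 ≤ x j := by
        have h1 := hx.1 j
        have h2 := hs.1 j
        simp at h1 h2
        linarith
      have h1 : 2 * lam * dirKb d b s x - lam ^ 2 ≤ dirKb d b s x ^ 2 := by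
        nlinarith [sq_nonneg (dirKb d b s x - lam)]
      calc _ ≤ Cf d * aR d / 2 * dirKb d b s x ^ 2 :=
            mul_le_mul_of_nonneg_left h1 (by positivity)
        _ = dirKb d b s x ^ 2 * (Cf d * (aR d / 2)) := by ring
        _ ≤ _ := by gcongr
    · rw [dirKb_notMem d b s x hxS]
      have : 0 ≤ Cf d * aR d / 2 * lam ^ 2 := by positivity
      simp; linarith
  have hfin : volume Q < ⊤ := isCompact_Icc.measure_lt_top
  have hcI : IntegrableOn (fun _ : Fin d → ℝ => lam ^ 2) Q :=
    by rw [integrableOn_const_iff]; exact Or.inr hfin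
  have hKI : IntegrableOn (fun x => 2 * lam * dirKb d b s x) Q :=
    ((integrable_dirKb d b hb s hsS).const_mul _).integrableOn
  have h1 : ∫ x in Q, Cf d * aR d / 2 * (2 * lam * dirKb d b s x - lam ^ 2) ≤
      ∫ x in Q, dirKb d b s x ^ 2 * f0 d j x :=
    setIntegral_mono_on ((hKI.sub hcI).const_mul _)
      (integrable_K2f d hd b hb hb1 s hs j).integrableOn measurableSet_Icc hpt
  have h2 : ∫ x in Q, dirKb d b s x ^ 2 * f0 d j x ≤ ∫ x, dirKb d b s x ^ 2 * f0 d j x :=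
    setIntegral_le_integral (integrable_K2f d hd b hb hb1 s hs j)
      (Eventually.of_forall fun x => mul_nonneg (sq_nonneg _) (f0_nonneg d j x))
  refine le_trans ?_ (h1.trans h2)
  rw [integral_const_mul, integral_sub hKI hcI, integral_const_mul, setIntegral_const, hvol]
  have e : clo d * (√b ^ d)⁻¹ = Cf d * aR d / 2 * (lam * (1 / 2)) := by
    unfold clo
    rw [hlam, hV, hh]
    field_simp
    ring
  rw [e]
  refine mul_le_mul_of_nonneg_left ?_ (by positivity)
  have : V • lam ^ 2 = lam * (1 / 2) := by
    rw [hlam, smul_eq_mul]; field_simp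
  rw [this]
  nlinarith


lemma quart_le (lam z : ℝ) (hlam0 : 0 < lam) : lam * z ^ 2 - lam ^ 3 * z ^ 4 ≤ |z| := by
  set t := lam * |z| with ht
  have ht0 : 0 ≤ t := by positivity
  have h1 : t ^ 2 ≤ t + t ^ 4 := by
    rcases le_total t 1 with h | h
    · nlinarith [pow_nonneg ht0 4]
    · nlinarith [pow_le_pow_right₀ h (show 2 ≤ 4 by norm_num)]
  have e4 : |z| ^ 4 = z ^ 4 := by
    have h := sq_abs z
    calc |z| ^ 4 = (|z| ^ 2) ^ 2 := by ring
      _ = z ^ 4 := by rw [h]; ring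
  have e : lam * (lam * z ^ 2 - lam ^ 3 * z ^ 4) = t ^ 2 - t ^ 4 := by
    rw [ht, mul_pow, mul_pow, sq_abs, e4]
    ring
  have h2 : lam * (lam * z ^ 2 - lam ^ 3 * z ^ 4) ≤ lam * |z| := by rw [e]; linarith
  exact le_of_mul_le_mul_left h2 hlam0

section abstractMoments

variable {E : Type*} [MeasurableSpace E] (P : Measure E) [IsProbabilityMeasure P]

lemma integrable_bdd {Ω : Type*} [MeasurableSpace Ω] (μ : Measure Ω) [IsFiniteMeasure μ]
    (F : Ω → ℝ) (hF : Measurable F) (C : ℝ) (hC : ∀ x, |F x| ≤ C) : Integrable F μ :=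
  Integrable.of_bound hF.aestronglyMeasurable C (Eventually.of_forall hC)

lemma sum_moments (n : ℕ) (g : E → ℝ) (hg : Measurable g) (B : ℝ) (hB : ∀ x, |g x| ≤ B)
    (h0 : ∫ x, g x ∂P = 0) (I : Finset (Fin n)) :
    (∫ ω, (∑ i ∈ I, g (ω i)) ∂(Measure.pi fun _ : Fin n => P)) = 0 ∧
    (∫ ω, (∑ i ∈ I, g (ω i)) ^ 2 ∂(Measure.pi fun _ : Fin n => P)) = I.card * ∫ x, g x ^ 2 ∂P ∧
    (∫ ω, (∑ i ∈ I, g (ω i)) ^ 4 ∂(Measure.pi fun _ : Fin n => P)) ≤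
      I.card * (B ^ 2 * ∫ x, g x ^ 2 ∂P) + 3 * I.card ^ 2 * (∫ x, g x ^ 2 ∂P) ^ 2 := by
  have hB0 : 0 ≤ B := by
    obtain ⟨x⟩ := P.nonempty_of_neZero
    exact (abs_nonneg _).trans (hB x)
  set μ := Measure.pi fun _ : Fin n => P with hμ
  induction I using Finset.induction_on with
  | empty => simp
  | insert i I hi ih =>
    obtain ⟨e1, e2, e4⟩ := ih
    set σ2 := ∫ x, g x ^ 2 ∂P with hσ
    have hσ0 : 0 ≤ σ2 := integral_nonneg fun x => sq_nonneg _
    set S : (Fin n → E) → ℝ := fun ω => ∑ j ∈ I, g (ω j) with hS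
    set G : (Fin n → E) → ℝ := fun ω => g (ω i) with hG
    have hSm : Measurable S := by
      apply Finset.measurable_sum
      intro j _
      exact hg.comp (measurable_pi_apply j)
    have hGm : Measurable G := hg.comp (measurable_pi_apply i)
    have hSb : ∀ ω, |S ω| ≤ I.card * B := by
      intro ω
      calc _ ≤ ∑ j ∈ I, |g (ω j)| := Finset.abs_sum_le_sum_abs _ _
        _ ≤ ∑ _j ∈ I, B := Finset.sum_le_sum fun j _ => hB _
        _ = _ := by simp
    have hind0 : ProbabilityTheory.iIndepFun (fun (j : Fin n) (ω : Fin n → E) => g (ω j)) μ :=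
      ProbabilityTheory.iIndepFun_pi fun _ => hg.aemeasurable
    have hind : ProbabilityTheory.IndepFun S G μ := by
      have := hind0.indepFun_finsetSum_of_notMem (fun j => hg.comp (measurable_pi_apply j)) hi
      convert this using 1
      ext ω; simp [hS]
    have hint : ∀ k l : ℕ, Integrable (fun ω => S ω ^ k * G ω ^ l) μ := by
      intro k l
      refine integrable_bdd μ _ (by fun_prop) ((I.card * B) ^ k * B ^ l) fun ω => ?_
      rw [abs_mul, abs_pow, abs_pow]
      exact mul_le_mul (pow_le_pow_left₀ (abs_nonneg _) (hSb ω) k)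
        (pow_le_pow_left₀ (abs_nonneg _) (hB _) l) (by positivity) (by positivity)
    have hGk : ∀ l : ℕ, ∫ ω, G ω ^ l ∂μ = ∫ x, g x ^ l ∂P := by
      intro l
      exact integral_comp_eval (μ := fun _ : Fin n => P) (i := i) (f := fun x => g x ^ l)
        (hg.pow_const l).aestronglyMeasurable
    have hmul : ∀ k l : ℕ, ∫ ω, S ω ^ k * G ω ^ l ∂μ = (∫ ω, S ω ^ k ∂μ) * ∫ x, g x ^ l ∂P := by
      intro k l
      rw [← hGk]
      exact (hind.comp (φ := fun x => x ^ k) (ψ := fun x => x ^ l) (by fun_prop)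
        (by fun_prop)).integral_fun_mul_eq_mul_integral
        (hSm.pow_const k).aestronglyMeasurable (hGm.pow_const l).aestronglyMeasurable
    have hg1 : ∫ x, g x ^ 1 ∂P = 0 := by simpa using h0
    have hS1 : ∫ ω, S ω ^ 1 ∂μ = 0 := by simpa using e1
    have hg4 : ∫ x, g x ^ 4 ∂P ≤ B ^ 2 * σ2 := by
      rw [hσ, ← integral_const_mul]
      refine integral_mono (integrable_bdd P _ (hg.pow_const 4) (B ^ 4) fun x => ?_)
        (integrable_bdd P _ ((hg.pow_const 2).const_mul _) (B ^ 2 * B ^ 2) fun x => ?_) fun x => ?_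
      · rw [abs_pow]; exact pow_le_pow_left₀ (abs_nonneg _) (hB x) 4
      · rw [abs_mul, abs_pow, abs_pow, abs_of_nonneg hB0]
        gcongr; exact hB x
      · have : g x ^ 2 ≤ B ^ 2 := by rw [← sq_abs]; exact pow_le_pow_left₀ (abs_nonneg _) (hB x) 2
        show g x ^ 4 ≤ B ^ 2 * g x ^ 2
        nlinarith [sq_nonneg (g x)]
    have hc : ((insert i I).card : ℝ) = I.card + 1 := by
      rw [Finset.card_insert_of_notMem hi]; push_cast; ring
    have hins : ∀ ω : Fin n → E, ∑ j ∈ insert i I, g (ω j) = G ω + S ω := fun ω => by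
      rw [Finset.sum_insert hi]
    simp_rw [hins]
    rw [hc]
    refine ⟨?_, ?_, ?_⟩
    · have e : ∀ ω, G ω + S ω = S ω ^ 0 * G ω ^ 1 + S ω ^ 1 * G ω ^ 0 := fun ω => by ring
      simp_rw [e]
      rw [integral_add (hint 0 1) (hint 1 0), hmul, hmul, hg1, hS1]; ring
    · have e : ∀ ω, (G ω + S ω) ^ 2 = (S ω ^ 0 * G ω ^ 2 + 2 * (S ω ^ 1 * G ω ^ 1)) +
          S ω ^ 2 * G ω ^ 0 := fun ω => by ring
      simp_rw [e]
      have a1 : Integrable (fun ω => S ω ^ 0 * G ω ^ 2 + 2 * (S ω ^ 1 * G ω ^ 1)) μ :=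
        (hint 0 2).add ((hint 1 1).const_mul 2)
      rw [integral_add a1 (hint 2 0), integral_add (hint 0 2) ((hint 1 1).const_mul 2),
        integral_const_mul, hmul, hmul, hmul, hg1, hS1, e2]
      simp
      ring
    · have e : ∀ ω, (G ω + S ω) ^ 4 = S ω ^ 4 * G ω ^ 0 + (4 * (S ω ^ 3 * G ω ^ 1) +
          (6 * (S ω ^ 2 * G ω ^ 2) + (4 * (S ω ^ 1 * G ω ^ 3) + S ω ^ 0 * G ω ^ 4))) :=
        fun ω => by ring
      simp_rw [e]
      have a1 : Integrable (fun ω => 4 * (S ω ^ 1 * G ω ^ 3) + S ω ^ 0 * G ω ^ 4) μ :=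
        ((hint 1 3).const_mul 4).add (hint 0 4)
      have a2 : Integrable (fun ω => 6 * (S ω ^ 2 * G ω ^ 2) +
          (4 * (S ω ^ 1 * G ω ^ 3) + S ω ^ 0 * G ω ^ 4)) μ :=
        ((hint 2 2).const_mul 6).add a1
      have a3 : Integrable (fun ω => 4 * (S ω ^ 3 * G ω ^ 1) + (6 * (S ω ^ 2 * G ω ^ 2) +
          (4 * (S ω ^ 1 * G ω ^ 3) + S ω ^ 0 * G ω ^ 4))) μ :=
        ((hint 3 1).const_mul 4).add a2
      rw [integral_add (hint 4 0) a3, integral_add ((hint 3 1).const_mul 4) a2,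
        integral_add ((hint 2 2).const_mul 6) a1, integral_add ((hint 1 3).const_mul 4) (hint 0 4),
        integral_const_mul, integral_const_mul, integral_const_mul]
      rw [hmul, hmul, hmul, hmul, hmul, hg1, hS1, e2]
      simp
      nlinarith [sq_nonneg σ2]


set_option maxHeartbeats 2000000 in
lemma l1_lower (n : ℕ) (hn : 1 ≤ n) (Y : E → ℝ) (hY : Measurable Y) (B c1 c2 c3 T ρ κ : ℝ)
    (hY0 : ∀ x, 0 ≤ Y x) (hYB : ∀ x, Y x ≤ B) (hT : 0 < T) (hc3 : B ≤ c3 * T)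
    (hlo : c1 * T ≤ ∫ x, (Y x - ∫ z, Y z ∂P) ^ 2 ∂P)
    (hup : ∫ x, (Y x - ∫ z, Y z ∂P) ^ 2 ∂P ≤ c2 * T) (hρ : 0 < ρ) (hρ1 : ρ ≤ 1)
    (hρT : ρ ^ 2 ≤ T / n) (hκ : 0 < κ) (hκ2 : κ ^ 2 * (c3 ^ 2 + 3 * c2) ≤ 1 / 2) (y : ℝ) :
    κ * ρ * c1 / 4 ≤ ∫ ω, |(n : ℝ)⁻¹ * ∑ i, Y (ω i) - y| ∂(Measure.pi fun _ : Fin n => P) := by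
  have hB0 : 0 ≤ B := by
    obtain ⟨x⟩ := P.nonempty_of_neZero
    exact (hY0 x).trans (hYB x)
  have hYint : Integrable Y P := integrable_bdd P Y hY B fun x => by
    rw [abs_of_nonneg (hY0 x)]; exact hYB x
  set m := ∫ z, Y z ∂P with hm
  have hm0 : 0 ≤ m := integral_nonneg hY0
  have hmB : m ≤ B := by
    calc m ≤ ∫ _z, B ∂P := integral_mono hYint (integrable_const _) hYB
      _ = B := by simp
  set σ2 := ∫ x, (Y x - m) ^ 2 ∂P with hσ
  have hσ0 : 0 ≤ σ2 := integral_nonneg fun x => sq_nonneg _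
  have hgb : ∀ x, |Y x - m| ≤ B := fun x => by
    rw [abs_le]; constructor <;> linarith [hY0 x, hYB x]
  have hg0 : ∫ x, (Y x - m) ∂P = 0 := by
    rw [integral_sub hYint (integrable_const _)]; simp [hm]
  obtain ⟨e1, e2, e4⟩ := sum_moments P n (fun x => Y x - m) (hY.sub_const m) B hgb hg0 Finset.univ
  set μ := Measure.pi fun _ : Fin n => P with hμ
  rw [Finset.card_univ, Fintype.card_fin] at e2 e4
  simp only [← hσ] at e2 e4
  have hn0 : (0:ℝ) < n := by exact_mod_cast hn
  set F : (Fin n → E) → ℝ := fun ω => (n : ℝ)⁻¹ * ∑ i, Y (ω i) with hF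
  set Z : (Fin n → E) → ℝ := fun ω => (n : ℝ)⁻¹ * ∑ i, (Y (ω i) - m) with hZ
  have hZF : ∀ ω, Z ω = F ω - m := by
    intro ω
    simp only [hZ, hF, Finset.sum_sub_distrib, mul_sub]
    simp; field_simp
  have hFm : Measurable F := by
    refine Measurable.const_mul (Finset.measurable_sum _ fun j _ => ?_) _
    exact hY.comp (measurable_pi_apply j)
  have hFb : ∀ ω, |F ω| ≤ B := by
    intro ω
    have h1 : ∑ i, Y (ω i) ≤ ∑ _i : Fin n, B := Finset.sum_le_sum fun i _ => hYB _
    have h2 : 0 ≤ ∑ i, Y (ω i) := Finset.sum_nonneg fun i _ => hY0 _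
    simp at h1
    rw [abs_of_nonneg (by positivity)]
    show (n : ℝ)⁻¹ * _ ≤ _
    rw [inv_mul_le_iff₀ hn0]; exact h1
  have hFi : Integrable F μ := integrable_bdd μ F hFm B hFb
  have hZm : Measurable Z := by
    have : Z = fun ω => F ω - m := funext hZF
    rw [this]; exact hFm.sub_const m
  have hZb : ∀ ω, |Z ω| ≤ B + B := fun ω => by
    rw [hZF]
    calc _ ≤ |F ω| + |m| := abs_sub _ _
      _ ≤ _ := by rw [abs_of_nonneg hm0]; linarith [hFb ω]
  have hZk : ∀ k : ℕ, Integrable (fun ω => Z ω ^ k) μ := fun k =>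
    integrable_bdd μ _ (hZm.pow_const k) ((B + B) ^ k) fun ω => by
      rw [abs_pow]; exact pow_le_pow_left₀ (abs_nonneg _) (hZb ω) k
  have hZ1 : Integrable (fun ω => |Z ω|) μ := by
    have := (hZk 1).abs
    simpa using this
  have z2 : ∫ ω, Z ω ^ 2 ∂μ = σ2 / n := by
    simp only [hZ, mul_pow]
    rw [integral_const_mul, e2]
    field_simp
  have z4 : ∫ ω, Z ω ^ 4 ∂μ ≤ σ2 / n * (B ^ 2 / n ^ 2 + 3 * σ2 / n) := by
    simp only [hZ, mul_pow]
    rw [integral_const_mul]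
    calc _ ≤ ((n:ℝ)⁻¹) ^ 4 * (n * (B ^ 2 * σ2) + 3 * n ^ 2 * σ2 ^ 2) :=
          mul_le_mul_of_nonneg_left e4 (by positivity)
      _ = _ := by field_simp
  set τ := T / n with hτ
  have hτ0 : 0 < τ := by positivity
  have v1 : c1 * τ ≤ σ2 / n := by
    rw [hτ, ← mul_div_assoc]; gcongr
  have v2 : σ2 / n ≤ c2 * τ := by
    rw [hτ, ← mul_div_assoc]; gcongr
  set v := σ2 / n with hv
  have hv0 : 0 ≤ v := by positivity
  have vB : B ^ 2 / n ^ 2 ≤ c3 ^ 2 * τ ^ 2 := by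
    rw [← div_pow, ← mul_pow]
    refine pow_le_pow_left₀ (by positivity) ?_ 2
    rw [hτ, ← mul_div_assoc]; gcongr
  have z4' : ∫ ω, Z ω ^ 4 ∂μ ≤ v * (c3 ^ 2 * τ ^ 2 + 3 * c2 * τ) := by
    refine z4.trans (mul_le_mul_of_nonneg_left ?_ hv0)
    have : 3 * σ2 / n = 3 * v := by rw [hv]; ring
    rw [this]; linarith
  have hc2 : 0 ≤ c2 := by
    by_contra hcon
    push Not at hcon
    nlinarith
  set lam := κ * ρ / τ with hlam
  have hlam0 : 0 < lam := by positivity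
  have hbr : lam ^ 2 * (c3 ^ 2 * τ ^ 2 + 3 * c2 * τ) ≤ 1 / 2 := by
    have e : lam ^ 2 * (c3 ^ 2 * τ ^ 2 + 3 * c2 * τ) =
        κ ^ 2 * (c3 ^ 2 * ρ ^ 2 + 3 * c2 * (ρ ^ 2 / τ)) := by
      rw [hlam]; field_simp
    rw [e]
    refine le_trans ?_ hκ2
    refine mul_le_mul_of_nonneg_left ?_ (by positivity)
    have r1 : ρ ^ 2 ≤ 1 := pow_le_one₀ hρ.le hρ1
    have r2 : ρ ^ 2 / τ ≤ 1 := by rw [div_le_one hτ0]; exact hρT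
    nlinarith [sq_nonneg c3]
  have hpt : ∀ ω, lam * Z ω ^ 2 - lam ^ 3 * Z ω ^ 4 ≤ |Z ω| := fun ω => quart_le lam (Z ω) hlam0
  have hZlo : κ * ρ * c1 / 2 ≤ ∫ ω, |Z ω| ∂μ := by
    have h1 : ∫ ω, (lam * Z ω ^ 2 - lam ^ 3 * Z ω ^ 4) ∂μ ≤ ∫ ω, |Z ω| ∂μ :=
      integral_mono (((hZk 2).const_mul _).sub ((hZk 4).const_mul _)) hZ1 hpt
    rw [integral_sub ((hZk 2).const_mul _) ((hZk 4).const_mul _), integral_const_mul,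
      integral_const_mul, z2] at h1
    have h2 : lam ^ 3 * ∫ ω, Z ω ^ 4 ∂μ ≤ lam * v * (1 / 2) := by
      calc _ ≤ lam ^ 3 * (v * (c3 ^ 2 * τ ^ 2 + 3 * c2 * τ)) :=
            mul_le_mul_of_nonneg_left z4' (by positivity)
        _ = lam * v * (lam ^ 2 * (c3 ^ 2 * τ ^ 2 + 3 * c2 * τ)) := by ring
        _ ≤ _ := mul_le_mul_of_nonneg_left hbr (by positivity)
    have h3 : κ * ρ * c1 ≤ lam * v := by
      calc κ * ρ * c1 = lam * (c1 * τ) := by rw [hlam]; field_simp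
        _ ≤ _ := mul_le_mul_of_nonneg_left v1 hlam0.le
    linarith
  have hFy : Integrable (fun ω => F ω - y) μ := hFi.sub (integrable_const _)
  have hFint : ∫ ω, (F ω - y) ∂μ = m - y := by
    have hz : ∫ ω, Z ω ∂μ = 0 := by
      simp only [hZ]; rw [integral_const_mul, e1, mul_zero]
    have : ∀ ω, F ω - y = Z ω + (m - y) := fun ω => by rw [hZF]; ring
    simp_rw [this]
    have hZi : Integrable Z μ := by simpa using hZk 1
    rw [integral_add hZi (integrable_const _), hz]; simp
  have hb1 : |m - y| ≤ ∫ ω, |F ω - y| ∂μ := by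
    rw [← hFint]; exact abs_integral_le_integral_abs
  have hb2 : ∫ ω, |Z ω| ∂μ ≤ ∫ ω, (|F ω - y| + |m - y|) ∂μ := by
    refine integral_mono hZ1 (hFy.abs.add (integrable_const _)) fun ω => ?_
    show |Z ω| ≤ |F ω - y| + |m - y|
    rw [hZF, show F ω - m = (F ω - y) - (m - y) by ring]
    exact abs_sub _ _
  rw [integral_add hFy.abs (integrable_const _)] at hb2
  simp at hb2
  show _ ≤ ∫ ω, |F ω - y| ∂μ
  linarith

lemma l1_bias (n : ℕ) (hn : 1 ≤ n) (Y : E → ℝ) (hYint : Integrable Y P) (y : ℝ) :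
    |∫ x, Y x ∂P - y| ≤ ∫ ω, |(n : ℝ)⁻¹ * ∑ i, Y (ω i) - y| ∂(Measure.pi fun _ : Fin n => P) := by
  have hn0 : (0:ℝ) < n := by exact_mod_cast hn
  have hi : ∀ i : Fin n, Integrable (fun ω : Fin n → E => Y (ω i)) (Measure.pi fun _ : Fin n => P) :=
    fun i => integrable_comp_eval (μ := fun _ : Fin n => P) hYint
  have he : ∀ i : Fin n, ∫ ω : Fin n → E, Y (ω i) ∂(Measure.pi fun _ : Fin n => P) = ∫ x, Y x ∂P :=
    fun i => integral_comp_eval (μ := fun _ : Fin n => P) hYint.aestronglyMeasurable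
  have : ∫ ω, ((n : ℝ)⁻¹ * ∑ i, Y (ω i) - y) ∂(Measure.pi fun _ : Fin n => P) =
      ∫ x, Y x ∂P - y := by
    rw [integral_sub ((integrable_finsetSum _ fun i _ => hi i).const_mul _) (integrable_const _),
      integral_const_mul, integral_finsetSum _ fun i _ => hi i]
    simp_rw [he]
    simp; field_simp
  rw [← this]
  exact abs_integral_le_integral_abs

end abstractMoments


def P0m (d : ℕ) (j : Fin d) : Measure (Fin d → ℝ) :=
  volume.withDensity (fun x => ENNReal.ofReal (f0 d j x))

instance P0m_prob (d : ℕ) (j : Fin d) : IsProbabilityMeasure (P0m d j) := by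
  constructor
  unfold P0m
  rw [withDensity_apply _ MeasurableSet.univ]
  simpa using lintegral_f0 d j

lemma integral_P0m (d : ℕ) (j : Fin d) (g : (Fin d → ℝ) → ℝ) :
    ∫ x, g x ∂(P0m d j) = ∫ x, f0 d j x * g x := by
  unfold P0m
  rw [integral_withDensity_eq_integral_toReal_smul (measurable_f0 d j).ennreal_ofReal
    (Eventually.of_forall fun x => ENNReal.ofReal_lt_top)]
  refine integral_congr_ae (Eventually.of_forall fun x => ?_)
  simp only [smul_eq_mul]
  rw [ENNReal.toReal_ofReal (f0_nonneg d j x)]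

lemma pi_P0m (d n : ℕ) (j : Fin d) : (Measure.pi fun _ : Fin n => P0m d j) =
    volume.withDensity (fun ω : Fin n → Fin d → ℝ => ENNReal.ofReal (∏ i, f0 d j (ω i))) := by
  refine Measure.pi_eq fun s hs => ?_
  rw [withDensity_apply _ (MeasurableSet.univ_pi hs)]
  have hr : (volume : Measure (Fin n → Fin d → ℝ)).restrict (Set.univ.pi s) =
      Measure.pi fun i => volume.restrict (s i) := by
    rw [volume_pi, Measure.restrict_pi_pi]
  have hii : Integrable (fun ω : Fin n → Fin d → ℝ => ∏ i, f0 d j (ω i))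
      (volume.restrict (Set.univ.pi s)) := by
    rw [hr]
    exact Integrable.fintype_prod_dep fun i => (integrable_f0 d j).restrict
  rw [← ofReal_integral_eq_lintegral_ofReal hii
    (Eventually.of_forall fun ω => Finset.prod_nonneg fun i _ => f0_nonneg d j _), hr,
    integral_fintype_prod_eq_prod (fun _ => f0 d j),
    ENNReal.ofReal_prod_of_nonneg fun i _ => integral_nonneg fun x => f0_nonneg d j x]
  refine Finset.prod_congr rfl fun i _ => ?_
  unfold P0m
  rw [withDensity_apply _ (hs i), ofReal_integral_eq_lintegral_ofReal (integrable_f0 d j).restrict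
    (Eventually.of_forall fun x => f0_nonneg d j x)]

lemma lpRisk_eq (d n : ℕ) (j : Fin d) (b p : ℝ) : lpRiskPow d n b p (f0 d j) =
    ∫ ω, (∫ s in Sd d, |fhat d n b ω s - f0 d j s| ^ p) ∂(Measure.pi fun _ : Fin n => P0m d j) := by
  rw [pi_P0m, integral_withDensity_eq_integral_toReal_smul _
    (Eventually.of_forall fun x => ENNReal.ofReal_lt_top)]
  · unfold lpRiskPow
    refine integral_congr_ae (Eventually.of_forall fun x => ?_)
    simp only [smul_eq_mul]
    rw [ENNReal.toReal_ofReal (Finset.prod_nonneg fun i _ => f0_nonneg d j _)]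
  · refine Measurable.ennreal_ofReal (Finset.measurable_prod _ fun i _ => ?_)
    exact (measurable_f0 d j).comp (measurable_pi_apply i)

/-- Pointwise lower bound constants -/
lemma Rbox_le (d : ℕ) (s : Fin d → ℝ) (hs : s ∈ Rbox d) (j : Fin d) : ((d : ℝ) + 1) * s j ≤ 3 / 4 := by
  have h := hs.2 j
  have h2 : s j ≤ 3 / 2 * (1 / (2 * ((d:ℝ) + 1))) := h
  have hd : (0:ℝ) < d + 1 := by positivity
  calc ((d : ℝ) + 1) * s j ≤ (d + 1) * (3 / 2 * (1 / (2 * ((d:ℝ) + 1)))) := by gcongr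
    _ = 3 / 4 := by field_simp; norm_num

lemma mean_Y (d : ℕ) (j : Fin d) (b : ℝ) (hb : 0 < b) (s : Fin d → ℝ) (hs : s ∈ Sd d) :
    ∫ x, dirKb d b s x ∂(P0m d j) = Cf d * ((s j + b) / (1 + (d + 1) * b)) := by
  rw [integral_P0m, ← integral_mul_dirKb d b hb s hs j, ← integral_const_mul]
  refine integral_congr_ae (Eventually.of_forall fun x => ?_)
  by_cases hx : x ∈ Sd d
  · simp only [f0_eq d j x hx]; ring
  · simp only [dirKb_notMem d b s x hx]; ring

lemma bias_lo (d : ℕ) (j : Fin d) (b : ℝ) (hb : 0 < b) (hb1 : b < 1) (s : Fin d → ℝ)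
    (hs : s ∈ Rbox d) :
    Cf d / (4 * (d + 2)) * b ≤ |∫ x, dirKb d b s x ∂(P0m d j) - f0 d j s| := by
  have hsS := Rbox_sub d hs
  rw [mean_Y d j b hb s hsS, f0_eq d j s hsS]
  have hC := Cf_pos d
  have hr := Rbox_le d s hs j
  have hd : (0:ℝ) ≤ d := by positivity
  have e : Cf d * ((s j + b) / (1 + (d + 1) * b)) - Cf d * s j =
      Cf d * b * ((1 - (d + 1) * s j) / (1 + (d + 1) * b)) := by
    field_simp; ring
  rw [e]
  refine le_trans ?_ (le_abs_self _)
  have h1 : 1 / (4 * ((d:ℝ) + 2)) ≤ (1 - (d + 1) * s j) / (1 + (d + 1) * b) := by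
    rw [div_le_div_iff₀ (by positivity) (by positivity)]
    nlinarith
  calc Cf d / (4 * (d + 2)) * b = Cf d * b * (1 / (4 * ((d:ℝ) + 2))) := by ring
    _ ≤ _ := by gcongr

lemma var_bounds (d : ℕ) (hd : 1 ≤ d) (j : Fin d) (b : ℝ) (hb : 0 < b) (hb1 : b < 1)
    (s : Fin d → ℝ) (hs : s ∈ Rbox d) (hb2 : Mc d * √b ≤ aR d / 2)
    (hb3 : 2 * Cf d ^ 2 ≤ clo d * (√b ^ d)⁻¹) :
    clo d / 2 * (√b ^ d)⁻¹ ≤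
      ∫ x, (dirKb d b s x - ∫ z, dirKb d b s z ∂(P0m d j)) ^ 2 ∂(P0m d j) ∧
    ∫ x, (dirKb d b s x - ∫ z, dirKb d b s z ∂(P0m d j)) ^ 2 ∂(P0m d j) ≤
      CB d * Cf d * (√b ^ d)⁻¹ := by
  have hsS := Rbox_sub d hs
  have hC := Cf_pos d
  have hdn : (0:ℝ) ≤ d := by positivity
  set m := ∫ z, dirKb d b s z ∂(P0m d j) with hm
  set T := (√b ^ d)⁻¹ with hT
  have hT0 : 0 < T := by
    have : 0 < √b := Real.sqrt_pos.2 hb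
    positivity
  have hCB := CB_nonneg d
  have hm1 := mean_Y d j b hb s hsS
  rw [← hm] at hm1
  have hsj := hsS.1 j
  have hm0 : 0 ≤ m := by
    rw [hm1]; have := hsj.1; positivity
  have hmC : m ≤ Cf d := by
    rw [hm1]
    have : (s j + b) / (1 + (d + 1) * b) ≤ 1 := by
      rw [div_le_one (by positivity)]; nlinarith [hsj.2]
    nlinarith
  have hYb : ∀ x, |dirKb d b s x| ≤ CB d * T := fun x => by
    rw [abs_of_nonneg (dirKb_nonneg d b hb s hsS x)]
    exact dirKb_sup d hd b hb hb1 s x hs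
  have hYi : Integrable (dirKb d b s) (P0m d j) :=
    integrable_bdd _ _ (measurable_dirKb d b s) _ hYb
  have hY2 : Integrable (fun x => dirKb d b s x ^ 2) (P0m d j) :=
    integrable_bdd _ _ ((measurable_dirKb d b s).pow_const 2) ((CB d * T) ^ 2) fun x => by
      rw [abs_pow]; exact pow_le_pow_left₀ (abs_nonneg _) (hYb x) 2
  have hv : ∫ x, (dirKb d b s x - m) ^ 2 ∂(P0m d j) = ∫ x, dirKb d b s x ^ 2 ∂(P0m d j) - m ^ 2 := by
    have e : ∀ x, (dirKb d b s x - m) ^ 2 = dirKb d b s x ^ 2 - (2 * m * dirKb d b s x - m ^ 2) :=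
      fun x => by ring
    simp_rw [e]
    have hI : Integrable (fun x => 2 * m * dirKb d b s x - m ^ 2) (P0m d j) :=
      (hYi.const_mul _).sub (integrable_const _)
    rw [integral_sub hY2 hI, integral_sub (hYi.const_mul _) (integrable_const _),
      integral_const_mul, ← hm]
    simp; ring
  have h2lo : clo d * T ≤ ∫ x, dirKb d b s x ^ 2 ∂(P0m d j) := by
    rw [integral_P0m]
    have := second_lo d hd b hb hb1 s hs j hb2
    simp_rw [mul_comm (f0 d j _)]
    exact this
  have h2up : ∫ x, dirKb d b s x ^ 2 ∂(P0m d j) ≤ CB d * Cf d * T := by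
    calc ∫ x, dirKb d b s x ^ 2 ∂(P0m d j) ≤ ∫ x, CB d * T * dirKb d b s x ∂(P0m d j) := by
          refine integral_mono hY2 (hYi.const_mul _) fun x => ?_
          show dirKb d b s x ^ 2 ≤ CB d * T * dirKb d b s x
          rw [sq]
          exact mul_le_mul_of_nonneg_right (dirKb_sup d hd b hb hb1 s x hs)
            (dirKb_nonneg d b hb s hsS x)
      _ = CB d * T * m := by rw [integral_const_mul]
      _ ≤ CB d * T * Cf d := by gcongr
      _ = _ := by ring
  rw [hv]
  have hmm : m ^ 2 ≤ Cf d ^ 2 := pow_le_pow_left₀ hm0 hmC 2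
  constructor
  · nlinarith
  · nlinarith [sq_nonneg m]

/-- Pointwise L1 lower bound -/
lemma pointwise_lo (d : ℕ) (hd : 1 ≤ d) (j : Fin d) : ∃ c > 0, ∃ b0 > 0, ∀ (n : ℕ), 1 ≤ n →
    ∀ ρ b : ℝ, 0 < ρ → ρ ≤ 1 → 0 < b → b < 1 → (ρ ≤ b ∨ (b ≤ b0 ∧ ρ ^ 2 ≤ (√b ^ d)⁻¹ / n)) →
    ∀ s ∈ Rbox d,
    c * ρ ≤ ∫ ω, |fhat d n b ω s - f0 d j s| ∂(Measure.pi fun _ : Fin n => P0m d j) := by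
  have hC := Cf_pos d
  have hcl := clo_pos d hd
  have hMc := Mc_pos d hd
  have hCB := CB_nonneg d
  have haR := aR_pos d
  set K := CB d ^ 2 + 3 * (CB d * Cf d) with hK
  have hK0 : 0 ≤ K := by positivity
  set κ := √(1 / (2 * (K + 1))) with hκ
  have hκ0 : 0 < κ := Real.sqrt_pos.2 (by positivity)
  have hκ2 : κ ^ 2 * K ≤ 1 / 2 := by
    rw [hκ, Real.sq_sqrt (by positivity), div_mul_eq_mul_div, div_le_div_iff₀ (by positivity)
      (by positivity)]
    nlinarith
  set q := min 1 (min (aR d / 2 / Mc d) (clo d / (2 * Cf d ^ 2))) with hq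
  have hq0 : 0 < q := by
    rw [hq]; refine lt_min one_pos (lt_min (by positivity) (by positivity))
  refine ⟨min (Cf d / (4 * (d + 2))) (κ * (clo d / 2) / 4), lt_min (by positivity) (by positivity),
    q ^ 2, by positivity, ?_⟩
  intro n hn ρ b hρ hρ1 hb hb1 hor s hs
  have hsS := Rbox_sub d hs
  have hYb : ∀ x, dirKb d b s x ≤ CB d * (√b ^ d)⁻¹ := fun x => dirKb_sup d hd b hb hb1 s x hs
  have hY0 := dirKb_nonneg d b hb s hsS
  rcases hor with h | ⟨h, h2⟩
  · have h1 := bias_lo d j b hb hb1 s hs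
    have h3 := l1_bias (P0m d j) n hn (dirKb d b s) (integrable_bdd _ _ (measurable_dirKb d b s)
      (CB d * (√b ^ d)⁻¹) fun x => by rw [abs_of_nonneg (hY0 x)]; exact hYb x) (f0 d j s)
    refine le_trans ?_ (h1.trans h3)
    exact mul_le_mul (min_le_left _ _) h hρ.le (by positivity)
  · have hsb : √b ≤ q := by
      rw [show q = √(q ^ 2) from (Real.sqrt_sq hq0.le).symm]; exact Real.sqrt_le_sqrt h
    have hsb0 : 0 < √b := Real.sqrt_pos.2 hb
    have hq1 : q ≤ 1 := min_le_left _ _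
    have hq2 : q ≤ aR d / 2 / Mc d := (min_le_right _ _).trans (min_le_left _ _)
    have hq3 : q ≤ clo d / (2 * Cf d ^ 2) := (min_le_right _ _).trans (min_le_right _ _)
    have hb2 : Mc d * √b ≤ aR d / 2 := by
      rw [← le_div_iff₀' hMc]; exact hsb.trans hq2
    have hpow : √b ^ d ≤ clo d / (2 * Cf d ^ 2) := by
      calc √b ^ d ≤ √b ^ 1 := pow_le_pow_of_le_one hsb0.le (hsb.trans hq1) hd
        _ = √b := pow_one _
        _ ≤ _ := hsb.trans hq3
    have hb3 : 2 * Cf d ^ 2 ≤ clo d * (√b ^ d)⁻¹ := by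
      rw [le_div_iff₀ (by positivity)] at hpow
      rw [← div_eq_mul_inv, le_div_iff₀ (by positivity)]
      linarith
    obtain ⟨v1, v2⟩ := var_bounds d hd j b hb hb1 s hs hb2 hb3
    have h3 := l1_lower (P0m d j) n hn (dirKb d b s) (measurable_dirKb d b s)
      (CB d * (√b ^ d)⁻¹) (clo d / 2) (CB d * Cf d) (CB d) ((√b ^ d)⁻¹) ρ κ hY0 hYb
      (by positivity) le_rfl v1 v2 hρ hρ1 h2 hκ0 hκ2 (f0 d j s)
    refine le_trans ?_ h3
    calc _ ≤ κ * (clo d / 2) / 4 * ρ := by gcongr; exact min_le_right _ _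
      _ = _ := by ring


lemma measurable_realGamma : Measurable Real.Gamma := by
  refine measurable_of_tendsto_metrizable (f := fun n (s : ℝ) => Real.GammaSeq s n) (fun n => ?_) ?_
  · unfold Real.GammaSeq
    refine Measurable.div (Measurable.mul (measurable_const.pow measurable_id) measurable_const) ?_
    exact Finset.measurable_prod _ fun i _ => by fun_prop
  · rw [tendsto_pi_nhds]
    exact fun s => Real.GammaSeq_tendsto_Gamma s

lemma measurable_dirKb_joint (d : ℕ) (b : ℝ) :
    Measurable (fun q : (Fin d → ℝ) × (Fin d → ℝ) => dirKb d b q.2 q.1) := by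
  have hG := measurable_realGamma
  have e : (fun q : (Fin d → ℝ) × (Fin d → ℝ) => dirKb d b q.2 q.1) =
      Set.indicator (Prod.fst ⁻¹' (Sd d)) (fun q => Ak d b q.2 * Hk d b q.2 q.1) := by
    ext q
    by_cases hq : q.1 ∈ Sd d
    · rw [dirKb_eq d b q.2 q.1 hq, Set.indicator_of_mem (by exact hq)]
    · rw [dirKb_notMem d b q.2 q.1 hq, Set.indicator_of_notMem (by exact hq)]
  rw [e]
  refine Measurable.indicator ?_ (measurable_fst (measurableSet_Sd d))
  unfold Ak Hk
  have hs : ∀ i : Fin d, Measurable fun q : (Fin d → ℝ) × (Fin d → ℝ) => q.2 i := fun i =>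
    (measurable_pi_apply i).comp measurable_snd
  have hx : ∀ i : Fin d, Measurable fun q : (Fin d → ℝ) × (Fin d → ℝ) => q.1 i := fun i =>
    (measurable_pi_apply i).comp measurable_fst
  have hss : Measurable fun q : (Fin d → ℝ) × (Fin d → ℝ) => ∑ i, q.2 i :=
    Finset.measurable_sum _ fun i _ => hs i
  have hxs : Measurable fun q : (Fin d → ℝ) × (Fin d → ℝ) => ∑ i, q.1 i :=
    Finset.measurable_sum _ fun i _ => hx i
  have hv : Measurable fun q : (Fin d → ℝ) × (Fin d → ℝ) => (1 - ∑ i, q.2 i) / b :=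
    (measurable_const.sub hss).div_const b
  have hu : ∀ i, Measurable fun q : (Fin d → ℝ) × (Fin d → ℝ) => q.2 i / b := fun i =>
    (hs i).div_const b
  refine Measurable.mul (Measurable.div (hG.comp ?_) (Measurable.mul (hG.comp ?_) ?_)) ?_
  · exact (hv.add_const 1).add (Finset.measurable_sum _ fun i _ => (hu i).add_const 1)
  · exact hv.add_const 1
  · exact Finset.measurable_prod _ fun i _ => hG.comp ((hu i).add_const 1)
  · exact Measurable.mul ((measurable_const.sub hxs).pow hv)
      (Finset.measurable_prod _ fun i _ => (hx i).pow (hu i))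

lemma dirKb_bdd (d : ℕ) (b : ℝ) (hb : 0 < b) : ∃ C, ∀ s ∈ Sd d, ∀ x, |dirKb d b s x| ≤ C := by
  have hcont : ContinuousOn Real.Gamma (Set.Icc 1 (1 / b + 1)) := fun y hy =>
    (Real.differentiableAt_Gamma fun m hm => by
      have := hy.1
      have h2 : (0:ℝ) ≤ m := by positivity
      linarith).continuousAt.continuousWithinAt
  have hb1 : 0 < 1 / b := by positivity
  have hne : (Set.Icc 1 (1 / b + 1)).Nonempty := ⟨1, le_rfl, by linarith⟩
  obtain ⟨y0, hy0, hmin⟩ := isCompact_Icc.exists_isMinOn hne hcont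
  set δ := Real.Gamma y0 with hδ
  have hδ0 : 0 < δ := Real.Gamma_pos_of_pos (by linarith [hy0.1])
  have hΓ : 0 < Real.Gamma ((1 + (d + 1) * b) / b) := Real.Gamma_pos_of_pos (by positivity)
  refine ⟨Real.Gamma ((1 + (d + 1) * b) / b) / (δ * ∏ _i : Fin d, δ), fun s hs x => ?_⟩
  by_cases hx : x ∈ Sd d
  swap
  · rw [dirKb_notMem d b s x hx]
    simp only [abs_zero]; positivity
  rw [abs_of_nonneg (dirKb_nonneg d b hb s hs x), dirKb_eq d b s x hx]
  have hs0 : 0 ≤ ∑ i, s i := Finset.sum_nonneg fun i _ => (hs.1 i).1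
  have hx0 : 0 ≤ ∑ i, x i := Finset.sum_nonneg fun i _ => (hx.1 i).1
  have hA : Ak d b s ≤ Real.Gamma ((1 + (d + 1) * b) / b) / (δ * ∏ _i : Fin d, δ) := by
    unfold Ak
    rw [par_sum d b hb]
    refine div_le_div_of_nonneg_left hΓ.le (by positivity) ?_
    refine mul_le_mul ?_ ?_ (by positivity) ?_
    · refine hmin ⟨par_v d b hb s hs, ?_⟩
      gcongr; linarith
    · refine Finset.prod_le_prod (fun i _ => hδ0.le) fun i _ => hmin ⟨par_u d b hb s hs i, ?_⟩
      gcongr; exact (hs.1 i).2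
    · exact (Real.Gamma_pos_of_pos (by linarith [par_v d b hb s hs])).le
  have hH : Hk d b s x ≤ 1 := by
    unfold Hk
    have h1 : (1 - ∑ i, x i) ^ ((1 - ∑ i, s i) / b) ≤ 1 :=
      Real.rpow_le_one (by linarith [hx.2]) (by linarith)
        (div_nonneg (by linarith [hs.2]) hb.le)
    have h2 : ∏ i, (x i) ^ (s i / b) ≤ 1 :=
      Finset.prod_le_one (fun i _ => Real.rpow_nonneg (hx.1 i).1 _) fun i _ =>
        Real.rpow_le_one (hx.1 i).1 (hx.1 i).2 (div_nonneg (hs.1 i).1 hb.le)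
    exact mul_le_one₀ h1 (Finset.prod_nonneg fun i _ => Real.rpow_nonneg (hx.1 i).1 _) h2
  calc Ak d b s * Hk d b s x ≤ Ak d b s * 1 :=
        mul_le_mul_of_nonneg_left hH (Ak_pos d b hb s hs).le
    _ ≤ _ := by rw [mul_one]; exact hA

lemma jensen_pow {Ω : Type*} [MeasurableSpace Ω] (μ : Measure Ω) [IsFiniteMeasure μ]
    (hμ : μ.real Set.univ ≤ 1) (F : Ω → ℝ) (hF0 : ∀ x, 0 ≤ F x) (hF : Integrable F μ) (p : ℝ)
    (hp : 1 ≤ p) (hFp : Integrable (fun x => F x ^ p) μ) :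
    (∫ x, F x ∂μ) ^ p ≤ ∫ x, F x ^ p ∂μ := by
  set M := ∫ x, F x ∂μ with hM
  have hM0 : 0 ≤ M := integral_nonneg hF0
  rcases hM0.eq_or_lt with h | h
  · rw [← h, Real.zero_rpow (by linarith)]
    exact integral_nonneg fun x => Real.rpow_nonneg (hF0 x) _
  have hMp : 0 < M ^ p := Real.rpow_pos_of_pos h p
  have hpt : ∀ x, M ^ p * (1 - p) + M ^ p * p / M * F x ≤ F x ^ p := by
    intro x
    have hdiv : 0 ≤ F x / M := div_nonneg (hF0 x) h.le
    have := one_add_mul_self_le_rpow_one_add (s := F x / M - 1) (by linarith) hp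
    rw [show 1 + (F x / M - 1) = F x / M by ring, Real.div_rpow (hF0 x) h.le,
      le_div_iff₀ hMp] at this
    calc _ = (1 + p * (F x / M - 1)) * M ^ p := by field_simp; ring
      _ ≤ _ := this
  have hI := integral_mono ((integrable_const (M ^ p * (1 - p))).add
    (hF.const_mul (M ^ p * p / M))) hFp hpt
  have e : ∫ x, (M ^ p * (1 - p) + M ^ p * p / M * F x) ∂μ =
      μ.real Set.univ * (M ^ p * (1 - p)) + M ^ p * p := by
    rw [integral_add (integrable_const _) (hF.const_mul _), integral_const, integral_const_mul, ← hM]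
    simp only [smul_eq_mul]
    field_simp
  refine le_trans ?_ (e.symm.le.trans hI)
  have : 0 ≤ (1 - μ.real Set.univ) * (M ^ p * (p - 1)) :=
    mul_nonneg (by linarith) (mul_nonneg hMp.le (by linarith))
  nlinarith

lemma vol_Sd (d : ℕ) : volume (Sd d) ≤ 1 := by
  have hsub : Sd d ⊆ Set.Icc (fun _ => 0) (fun _ => 1) := fun s hs =>
    ⟨fun i => (hs.1 i).1, fun i => (hs.1 i).2⟩
  refine (measure_mono hsub).trans ?_
  rw [Real.volume_Icc_pi]; simp

lemma vol_Rbox (d : ℕ) : volume.real (Rbox d) = (aR d / 2) ^ d := by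
  have := aR_pos d
  unfold Rbox Measure.real
  rw [Real.volume_Icc_pi_toReal]
  · simp; ring
  · intro i; simp; linarith

lemma measurable_Delta (d n : ℕ) (b : ℝ) (j : Fin d) :
    Measurable (fun q : (Fin n → Fin d → ℝ) × (Fin d → ℝ) =>
      fhat d n b q.1 q.2 - f0 d j q.2) := by
  have hK : ∀ i : Fin n, Measurable (fun q : (Fin n → Fin d → ℝ) × (Fin d → ℝ) =>
      dirKb d b q.2 (q.1 i)) := by
    intro i
    have h1 : Measurable (fun q : (Fin n → Fin d → ℝ) × (Fin d → ℝ) => (q.1 i, q.2)) :=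
      ((measurable_pi_apply i).comp measurable_fst).prodMk measurable_snd
    exact Measurable.comp (f := fun q : (Fin n → Fin d → ℝ) × (Fin d → ℝ) => (q.1 i, q.2))
      (measurable_dirKb_joint d b) h1
  have hf : Measurable (fun q : (Fin n → Fin d → ℝ) × (Fin d → ℝ) => f0 d j q.2) :=
    (measurable_f0 d j).comp measurable_snd
  have hS : Measurable (fun q : (Fin n → Fin d → ℝ) × (Fin d → ℝ) =>
      ∑ i, dirKb d b q.2 (q.1 i)) := Finset.measurable_sum _ fun i _ => hK i
  have hh : Measurable (fun q : (Fin n → Fin d → ℝ) × (Fin d → ℝ) => fhat d n b q.1 q.2) :=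
    hS.const_mul ((n:ℝ)⁻¹)
  exact hh.sub hf

set_option maxHeartbeats 1000000 in
lemma risk_from_pointwise (d n : ℕ) (hn : 1 ≤ n) (j : Fin d) (b : ℝ) (hb : 0 < b) (p : ℝ) (hp : 1 ≤ p)
    (r : ℝ) (hr : 0 ≤ r) (h : ∀ s ∈ Rbox d, r ≤ ∫ ω, |fhat d n b ω s - f0 d j s|
      ∂(Measure.pi fun _ : Fin n => P0m d j)) :
    (aR d / 2) ^ d * r ≤ (lpRiskPow d n b p (f0 d j)) ^ (1 / p) := by
  have hn0 : (0:ℝ) < n := by exact_mod_cast hn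
  obtain ⟨C, hC⟩ := dirKb_bdd d b hb
  have haR := aR_pos d
  set π := Measure.pi fun _ : Fin n => P0m d j with hπ
  set ν := (volume : Measure (Fin d → ℝ)).restrict (Sd d) with hν
  have hνu : ν Set.univ ≤ 1 := by rw [hν, Measure.restrict_apply_univ]; exact vol_Sd d
  have : IsFiniteMeasure ν := ⟨hνu.trans_lt ENNReal.one_lt_top⟩
  set μ := π.prod ν with hμ
  have hμu : μ.real Set.univ ≤ 1 := by
    have : μ Set.univ ≤ 1 := by
      rw [hμ, ← Set.univ_prod_univ, Measure.prod_prod, measure_univ, one_mul]; exact hνu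
    exact ENNReal.toReal_le_of_le_ofReal zero_le_one (by simpa using this)
  have hDm := measurable_Delta d n b j
  set F : (Fin n → Fin d → ℝ) × (Fin d → ℝ) → ℝ := fun q => |fhat d n b q.1 q.2 - f0 d j q.2| with hF
  have hFm : Measurable F := by
    have := hDm.norm
    exact this
  have hF0 : ∀ q, 0 ≤ F q := fun q => abs_nonneg _
  have hFb : ∀ q : (Fin n → Fin d → ℝ) × (Fin d → ℝ), q.2 ∈ Sd d → F q ≤ C + Cf d := by
    intro q hq
    have h1 : |fhat d n b q.1 q.2| ≤ C := by
      unfold fhat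
      rw [abs_mul, abs_of_nonneg (by positivity : (0:ℝ) ≤ (n:ℝ)⁻¹), inv_mul_le_iff₀ hn0]
      calc _ ≤ ∑ i : Fin n, |dirKb d b q.2 (q.1 i)| := Finset.abs_sum_le_sum_abs _ _
        _ ≤ ∑ _i : Fin n, C := Finset.sum_le_sum fun i _ => hC _ hq _
        _ = _ := by simp
    calc F q ≤ |fhat d n b q.1 q.2| + |f0 d j q.2| := abs_sub _ _
      _ ≤ _ := by rw [abs_of_nonneg (f0_nonneg d j _)]; linarith [f0_le d j q.2]
  have hae : ∀ᵐ q ∂μ, q.2 ∈ Sd d := by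
    have h1 : ∀ᵐ s ∂ν, s ∈ Sd d := ae_restrict_mem (measurableSet_Sd d)
    exact Measure.quasiMeasurePreserving_snd.ae h1
  have hFi : Integrable F μ := by
    refine Integrable.of_bound hFm.aestronglyMeasurable (C + Cf d) ?_
    filter_upwards [hae] with q hq
    rw [Real.norm_of_nonneg (hF0 q)]; exact hFb q hq
  have hFp : Integrable (fun q => F q ^ p) μ := by
    refine Integrable.of_bound (hFm.pow_const p).aestronglyMeasurable ((C + Cf d) ^ p) ?_
    filter_upwards [hae] with q hq
    rw [Real.norm_of_nonneg (Real.rpow_nonneg (hF0 q) _)]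
    exact Real.rpow_le_rpow (hF0 q) (hFb q hq) (by linarith)
  have hrisk : lpRiskPow d n b p (f0 d j) = ∫ q, F q ^ p ∂μ := by
    rw [lpRisk_eq, hμ, integral_prod _ hFp]
  have hJ := jensen_pow μ hμu F hF0 hFi p hp hFp
  have hM : (aR d / 2) ^ d * r ≤ ∫ q, F q ∂μ := by
    rw [hμ, integral_prod_symm _ hFi, ← vol_Rbox d]
    have hgi : Integrable (fun s => ∫ ω, F (ω, s) ∂π) ν := hFi.integral_prod_right
    have hRm : MeasurableSet (Rbox d) := measurableSet_Icc
    have hRfin : volume (Rbox d) ≠ ⊤ := ((measure_mono (Rbox_sub d)).trans (vol_Sd d)).trans_lt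
      ENNReal.one_lt_top |>.ne
    calc volume.real (Rbox d) * r = ∫ _s in Rbox d, r := by
          rw [setIntegral_const]; simp
      _ ≤ ∫ s in Rbox d, (∫ ω, F (ω, s) ∂π) := by
          refine setIntegral_mono_on (integrableOn_const hRfin) ?_ hRm fun s hs => h s hs
          exact IntegrableOn.mono_set hgi (Rbox_sub d)
      _ ≤ ∫ s in Sd d, (∫ ω, F (ω, s) ∂π) := by
          refine setIntegral_mono_set hgi ?_ (Rbox_sub d).eventuallyLE
          exact Eventually.of_forall fun s => integral_nonneg fun ω => hF0 _
  rw [hrisk]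
  have hM0 : 0 ≤ ∫ q, F q ∂μ := integral_nonneg hF0
  refine hM.trans ?_
  calc ∫ q, F q ∂μ = ((∫ q, F q ∂μ) ^ p) ^ (1 / p) := by
        rw [← Real.rpow_mul hM0, mul_one_div_cancel (by linarith), Real.rpow_one]
    _ ≤ _ := Real.rpow_le_rpow (Real.rpow_nonneg hM0 _) hJ (by positivity)

lemma risk_lo (d : ℕ) (hd : 1 ≤ d) (j : Fin d) : ∃ c > 0, ∀ᶠ n : ℕ in atTop, ∀ b ∈ Set.Ioo (0:ℝ) 1,
    ∀ p : ℝ, 1 ≤ p →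
    c * (n:ℝ) ^ (-2 / ((d:ℝ) + 4)) ≤ (lpRiskPow d n b p (f0 d j)) ^ (1 / p) := by
  obtain ⟨c, hc, b0, hb0, H⟩ := pointwise_lo d hd j
  have haR := aR_pos d
  refine ⟨(aR d / 2) ^ d * c, by positivity, ?_⟩
  have hd4 : (0:ℝ) < d + 4 := by positivity
  have hlim : Tendsto (fun n : ℕ => (n:ℝ) ^ (-2 / ((d:ℝ) + 4))) atTop (𝓝 0) := by
    have := (tendsto_rpow_neg_atTop (y := 2 / ((d:ℝ) + 4)) (by positivity)).comp
      tendsto_natCast_atTop_atTop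
    refine this.congr fun n => ?_
    simp only [Function.comp]; rw [neg_div]
  filter_upwards [eventually_ge_atTop 1, hlim.eventually (gt_mem_nhds hb0)] with n hn hnb b hb p hp
  have hn1 : (1:ℝ) ≤ n := by exact_mod_cast hn
  have hn0 : (0:ℝ) < n := by linarith
  set ρ := (n:ℝ) ^ (-2 / ((d:ℝ) + 4)) with hρ
  have hρ0 : 0 < ρ := Real.rpow_pos_of_pos hn0 _
  have hρ1 : ρ ≤ 1 := Real.rpow_le_one_of_one_le_of_nonpos hn1
    (div_nonpos_of_nonpos_of_nonneg (by norm_num) hd4.le)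
  have hor : ρ ≤ b ∨ (b ≤ b0 ∧ ρ ^ 2 ≤ (√b ^ d)⁻¹ / n) := by
    rcases le_or_gt ρ b with h | h
    · exact Or.inl h
    · refine Or.inr ⟨(h.trans hnb).le, ?_⟩
      have hsb : 0 < √b := Real.sqrt_pos.2 hb.1
      have h1 : √b ^ d ≤ √ρ ^ d := pow_le_pow_left₀ hsb.le (Real.sqrt_le_sqrt h.le) d
      have h2 : ρ ^ 2 * n * √ρ ^ d = 1 := by
        have a1 : √ρ ^ d = (n:ℝ) ^ (-2 / ((d:ℝ) + 4) * (1 / 2) * d) := by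
          rw [Real.sqrt_eq_rpow, ← Real.rpow_natCast, hρ, ← Real.rpow_mul hn0.le,
            ← Real.rpow_mul hn0.le]
        have a2 : ρ ^ 2 = (n:ℝ) ^ (-2 / ((d:ℝ) + 4) * 2) := by
          rw [hρ, ← Real.rpow_natCast, ← Real.rpow_mul hn0.le]; norm_num
        rw [a1, a2]
        nth_rewrite 2 [← Real.rpow_one (n:ℝ)]
        rw [← Real.rpow_add hn0, ← Real.rpow_add hn0]
        have : -2 / ((d:ℝ) + 4) * 2 + 1 + -2 / ((d:ℝ) + 4) * (1 / 2) * d = 0 := by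
          field_simp; ring
        rw [this, Real.rpow_zero]
      rw [le_div_iff₀ hn0, ← one_div, le_div_iff₀ (by positivity), ← h2]
      gcongr
  rw [mul_assoc]
  exact risk_from_pointwise d n hn j b hb.1 p hp (c * ρ) (by positivity)
    (H n hn ρ b hρ0 hρ1 hb.1 hb.2 hor)

theorem dirichlet_not_minimax_beta_gt_two (d : ℕ) (hd : 1 ≤ d) (p β L : ℝ)
    (hp : 1 ≤ p) (hβ : 2 < β) (hL : 0 < L)
    (b : ℕ → ℝ) (hb : ∀ n, b n ∈ Set.Ioo (0 : ℝ) 1) :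
    Filter.liminf
      (fun n : ℕ =>
        (⨆ f ∈ holderClass d β L,
            ENNReal.ofReal ((lpRiskPow d n (b n) p f) ^ (1 / p))) /
          ENNReal.ofReal ((n : ℝ) ^ (-β / ((d : ℝ) + 2 * β))))
      Filter.atTop = ⊤ := by
  refine Tendsto.liminf_eq ?_
  have hd0 : (0:ℝ) < d := by exact_mod_cast hd
  obtain ⟨c, hc, H⟩ := risk_lo d hd ⟨0, hd⟩
  set θ := β / ((d:ℝ) + 2 * β) - 2 / ((d:ℝ) + 4) with hθ
  have hθ0 : 0 < θ := by
    rw [hθ, sub_pos, div_lt_div_iff₀ (by positivity) (by positivity)]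
    nlinarith
  have hlim : Tendsto (fun n : ℕ => ENNReal.ofReal (c * (n:ℝ) ^ θ)) atTop (𝓝 ⊤) := by
    refine ENNReal.tendsto_ofReal_atTop.comp ?_
    exact ((tendsto_rpow_atTop hθ0).comp tendsto_natCast_atTop_atTop).const_mul_atTop hc
  refine tendsto_nhds_top_mono hlim ?_
  filter_upwards [H, eventually_ge_atTop 1] with n hn hn1
  have hn0 : (0:ℝ) < n := by exact_mod_cast hn1
  have hpos : 0 < (n:ℝ) ^ (-β / ((d:ℝ) + 2 * β)) := Real.rpow_pos_of_pos hn0 _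
  have e : c * (n:ℝ) ^ θ = c * (n:ℝ) ^ (-2 / ((d:ℝ) + 4)) / (n:ℝ) ^ (-β / ((d:ℝ) + 2 * β)) := by
    rw [mul_div_assoc, ← Real.rpow_sub hn0, hθ]
    congr 2; ring
  rw [e, ENNReal.ofReal_div_of_pos hpos]
  refine ENNReal.div_le_div_right ?_ _
  refine le_trans (ENNReal.ofReal_le_ofReal (hn (b n) (hb n) p hp)) ?_
  exact le_iSup₂ (f := fun f (_ : f ∈ holderClass d β L) =>
    ENNReal.ofReal ((lpRiskPow d n (b n) p f) ^ (1 / p))) (f0 d ⟨0, hd⟩)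
    (f0_mem d ⟨0, hd⟩ β L hβ hL)
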